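/- arXiv:2101.09107 — 6 statements merged into one kernel-verified Lean document; each statement's English description precedes it below -/
import Mathlib

section
/- Result 4: under the flag constraint, for every 1 ≤ k < N and every history H_k with k distinct labs ℒ_k: Σ_{l ∈ ℒ_k} Σ_{t=1}^T ‖φ_{(l,t,H_k)}‖² = Σ_{l' ∉ ℒ_k} Σ_{t'=1}^T ‖ψ_{(l',t',H_k)}‖² (where l' ranges over labs in {1,…,N} not in ℒ_k). -/
noncomputable section

/-!
Shared framework: quantum protocols with a quantum control of causal order,
following Purves & Short, "Quantum theory cannot violate a causal inequality".

The total Hilbert space `H_s ⊗ H_c ⊗ (⊗ᵢ H_{rᵢ}) ⊗ (⊗ᵢ H_{fᵢ})` is modelled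
concretely as `ℓ²` of the finite basis-index set
`Idx = S × Fin (N+1) × (Π i, A i) × (Π i, Fin (T+1))`
(system basis, control basis |0⟩,…,|N⟩, result-register bases, flag bases),
vectors being functions `Idx → ℂ`, operators being matrices.
-/

namespace CIQ

variable {N T : ℕ} {S : Type} [Fintype S] [DecidableEq S]
variable {A : Fin N → Type} [∀ i, Fintype (A i)] [∀ i, DecidableEq (A i)]
variable {X : Fin N → Type} [∀ i, Fintype (X i)] [∀ i, DecidableEq (X i)]

/-- Basis index set of the total Hilbert space: system × control × results × flags. -/
abbrev Idx (N T : ℕ) (S : Type) (A : Fin N → Type) : Type :=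
  S × Fin (N + 1) × ((i : Fin N) → A i) × ((i : Fin N) → Fin (T + 1))

/-- A history: an ordered list of triples (lab, outcome, setting). -/
abbrev Hist (N : ℕ) (A X : Fin N → Type) : Type := List ((l : Fin N) × (A l × X l))

/-- The labs occurring in a history are pairwise distinct. -/
def labsDistinct (H : Hist N A X) : Prop := (H.map Sigma.fst).Nodup

/-- Squared ℓ²-norm ‖v‖². -/
def nsq (v : Idx N T S A → ℂ) : ℝ := ∑ p, Complex.normSq (v p)

/-- The ℓ² inner product ⟨v|w⟩ (conjugate-linear in the first argument). -/
def hinner (v w : Idx N T S A → ℂ) : ℂ := ∑ p, (starRingEnd ℂ) (v p) * w p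

/-- The data of a quantum protocol: a distinguished initial system basis state `s0`,
initial result-register states `r0`, measurement unitaries `Vm l x` on `H_s ⊗ H_{r_l}`
for each lab and setting, and inter-step unitaries `U t` on `H_s ⊗ H_c` (for `1 ≤ t ≤ T`). -/
structure Protocol (N T : ℕ) (S : Type) (A X : Fin N → Type) where
  s0 : S
  r0 : ∀ i, A i
  Vm : (l : Fin N) → X l → Matrix (S × A l) (S × A l) ℂ
  U : ℕ → Matrix (S × Fin (N + 1)) (S × Fin (N + 1)) ℂ

/-- Extension of an operator on `H_s ⊗ H_c` by the identity on results and flags. -/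
def extSC (M : Matrix (S × Fin (N + 1)) (S × Fin (N + 1)) ℂ) :
    Matrix (Idx N T S A) (Idx N T S A) ℂ := fun p q =>
  if p.2.2 = q.2.2 then M (p.1, p.2.1) (q.1, q.2.1) else 0

namespace Protocol

variable (P : Protocol N T S A X) (x : ∀ l, X l)

/-- Each measurement unitary is indeed unitary. -/
def unitaryVm : Prop := ∀ (l : Fin N) (xv : X l), P.Vm l xv ∈ Matrix.unitaryGroup (S × A l) ℂ

/-- Each inter-step unitary `U t`, `1 ≤ t ≤ T`, is indeed unitary. -/
def unitaryU : Prop :=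
  ∀ t : ℕ, 1 ≤ t → t ≤ T → P.U t ∈ Matrix.unitaryGroup (S × Fin (N + 1)) ℂ

/-- The initial state |0⟩ = |0⟩_s |0⟩_c |0⟩_r^N |0⟩_f^N. -/
def ket0 : Idx N T S A → ℂ :=
  fun p => if p = (P.s0, 0, P.r0, fun _ => 0) then 1 else 0

/-- The lab-activation unitary
`V = |0⟩⟨0|_c ⊗ I + Σ_{l=1}^N |l⟩⟨l|_c ⊗ V_{s,r_l}(x_l) ⊗ Γ_{f_l} ⊗ I`,
where `Γ` is the cyclic shift raising the flag. -/
def Vmat : Matrix (Idx N T S A) (Idx N T S A) ℂ := fun p q =>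
  if h : p.2.1 = (0 : Fin (N + 1)) then (if q = p then 1 else 0)
  else
    if q.2.1 = p.2.1 ∧ (∀ i, i ≠ p.2.1.pred h → q.2.2.1 i = p.2.2.1 i)
        ∧ (∀ i, i ≠ p.2.1.pred h → q.2.2.2 i = p.2.2.2 i)
        ∧ q.2.2.2 (p.2.1.pred h) + 1 = p.2.2.2 (p.2.1.pred h) then
      P.Vm (p.2.1.pred h) (x (p.2.1.pred h))
        (p.1, p.2.2.1 (p.2.1.pred h)) (q.1, q.2.2.1 (p.2.1.pred h))
    else 0

/-- `chain t = V U_t V U_{t-1} ⋯ V U_1`. -/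
def chain : ℕ → Matrix (Idx N T S A) (Idx N T S A) ℂ
  | 0 => 1
  | t + 1 => P.Vmat x * (extSC (P.U (t + 1)) * chain t)

/-- `pre t = U_t V U_{t-1} ⋯ V U_1` (the evolution just before the `t`-th activation). -/
def pre (t : ℕ) : Matrix (Idx N T S A) (Idx N T S A) ℂ :=
  extSC (P.U t) * P.chain x (t - 1)

/-- The total unitary `𝒰 = V U_T V U_{T-1} ⋯ V U_1`. -/
def Uop : Matrix (Idx N T S A) (Idx N T S A) ℂ := P.chain x T

/-- `tailPhi k = V U_T V U_{T-1} ⋯ U_{T-k+1}` (evolution to the end of the protocol,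
starting just after the `(T-k)`-th activation); `k` counts remaining time steps. -/
def tailPhi : ℕ → Matrix (Idx N T S A) (Idx N T S A) ℂ
  | 0 => 1
  | k + 1 => tailPhi k * (P.Vmat x * extSC (P.U (T - k)))

end Protocol

/-- The condition imposed by the projector `π^H_{rf}`: result registers of labs in the
history `H` show the recorded outcomes and their flags are raised (to `1`), while the
flags of all other labs read `0`. -/
def histSat (H : Hist N A X) (rr : ∀ i, A i) (ff : (i : Fin N) → Fin (T + 1)) : Prop :=
  (∀ e ∈ H, rr e.1 = e.2.1 ∧ ff e.1 = 1) ∧ (∀ i : Fin N, (∀ e ∈ H, e.1 ≠ i) → ff i = 0)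

instance (H : Hist N A X) (rr : ∀ i, A i) (ff : (i : Fin N) → Fin (T + 1)) :
    Decidable (histSat H rr ff) := by
  unfold histSat; infer_instance

namespace Protocol

variable (P : Protocol N T S A X) (x : ∀ l, X l)

/-- `|ψ_{(l,t,H)}⟩ = (|l⟩⟨l|_c ⊗ π^H_{rf} ⊗ I_s) U_t V U_{t-1} ⋯ V U_1 |0⟩`,
where the control value `l ∈ {0,1,…,N}`. -/
def psi (l : Fin (N + 1)) (t : ℕ) (H : Hist N A X) : Idx N T S A → ℂ := fun p =>
  if p.2.1 = l ∧ histSat H p.2.2.1 p.2.2.2 then (P.pre x t).mulVec (P.ket0) p else 0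

/-- `|ψ̄_{(l,t,H)}⟩ = V U_T V U_{T-1} ⋯ U_{t+1} V |ψ_{(l,t,H)}⟩`. -/
def psibar (l : Fin (N + 1)) (t : ℕ) (H : Hist N A X) : Idx N T S A → ℂ :=
  (P.tailPhi x (T - t) * P.Vmat x).mulVec (P.psi x l t H)

/-- The just-measured state with previous history `H`:
`(|a⟩⟨a|_{r_l} ⊗ I) V |ψ_{(l,t,H)}⟩` (control value `l` among `1,…,N`). -/
def phiOf (l : Fin N) (a : A l) (t : ℕ) (H : Hist N A X) : Idx N T S A → ℂ := fun p =>
  if p.2.2.1 l = a then (P.Vmat x).mulVec (P.psi x l.succ t H) p else 0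

/-- `|φ_{(l,t,H)}⟩` for a lab `l` whose triple `(l, a, x_l)` occurs in the history `H`:
`(|a⟩⟨a|_{r_l} ⊗ I) V |ψ_{(l,t,H∖(l,a,x_l))}⟩`. -/
def phiFull (l : Fin N) (a : A l) (t : ℕ) (H : Hist N A X) : Idx N T S A → ℂ :=
  P.phiOf x l a t (H.filter fun e => decide (e.1 ≠ l))

/-- `|φ̄_{(l,t,H)}⟩ = V U_T V ⋯ U_{t+1} |φ_{(l,t,H)}⟩`. -/
def phibar (l : Fin N) (a : A l) (t : ℕ) (H : Hist N A X) : Idx N T S A → ℂ :=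
  (P.tailPhi x (T - t)).mulVec (P.phiFull x l a t H)

/-- `|φ_{(0,t,H)}⟩ = V |ψ_{(0,t,H)}⟩`. -/
def phi0 (t : ℕ) (H : Hist N A X) : Idx N T S A → ℂ :=
  (P.Vmat x).mulVec (P.psi x 0 t H)

/-- `|φ̄_{(0,t,H)}⟩ = V U_T V ⋯ U_{t+1} |φ_{(0,t,H)}⟩`. -/
def phibar0 (t : ℕ) (H : Hist N A X) : Idx N T S A → ℂ :=
  (P.tailPhi x (T - t)).mulVec (P.phi0 x t H)

/-- `Σ_{t=1}^T ‖ψ_{(l,t,H)}‖²` (numerator of Definition 4). -/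
def numPsi (H : Hist N A X) (l : Fin N) : ℝ :=
  ∑ t ∈ Finset.Icc 1 T, nsq (P.psi x l.succ t H)

/-- `Σ_{l'∉ℒ} Σ_{t=1}^T ‖ψ_{(l',t,H)}‖²` (denominator of Definition 4). -/
def denPsi (H : Hist N A X) : ℝ :=
  ∑ l ∈ Finset.univ.filter (fun l : Fin N => ∀ e ∈ H, e.1 ≠ l), P.numPsi x H l

/-- Definition 4: `p_k(l_k|H_{k-1})`, the probability for lab `l` to act next. -/
def pNext (H : Hist N A X) (l : Fin N) : ℝ := P.numPsi x H l / P.denPsi x H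

/-- `Σ_{t=1}^T ‖φ_{(l,t,(H,(l,a,x_l)))}‖²` (numerator of Definition 5). -/
def numPhi (H : Hist N A X) (l : Fin N) (a : A l) : ℝ :=
  ∑ t ∈ Finset.Icc 1 T, nsq (P.phiOf x l a t H)

/-- Definition 5: `p_k(a|H_{k-1},x_l)`, the probability for lab `l`, acting next after
history `H` with its setting `x l`, to obtain outcome `a`. -/
def pOut (H : Hist N A X) (l : Fin N) (a : A l) : ℝ :=
  P.numPhi x H l a / ∑ a' : A l, P.numPhi x H l a'

/-- The quantum outcome distribution
`p^quantum(a⃗|x⃗) = ‖(|a⃗⟩⟨a⃗|_r ⊗ I) 𝒰 |0⟩‖²`. -/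
def pQ (a : ∀ i, A i) : ℝ :=
  nsq (fun p => if p.2.2.1 = a then (P.Uop x).mulVec P.ket0 p else 0)

/-- The flag constraint: at the end of the protocol every flag reads `1`
(each party has interacted with the system exactly once). -/
def flagOK : Prop :=
  ∀ p : Idx N T S A, (P.Uop x).mulVec P.ket0 p ≠ 0 → ∀ i, p.2.2.2 i = 1

end Protocol

/-- The causal-model expression of Definition 1, written recursively:
`causalSum q o x a k H` sums over the next `k` parties to act (those not in `H`),
multiplying the 'who is next?' probabilities `q` and the 'what did they see?'
probabilities `o`, with the history extended accordingly.  The full expression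
of Definition 1 is `causalSum q o x a N []`. -/
def causalSum (q : Hist N A X → Fin N → ℝ)
    (o : Hist N A X → (l : Fin N) → X l → A l → ℝ)
    (x : ∀ i, X i) (a : ∀ i, A i) : ℕ → Hist N A X → ℝ
  | 0, _ => 1
  | k + 1, H =>
      ∑ l : Fin N,
        if ∀ e ∈ H, e.1 ≠ l then
          q H l * o H l (x l) (a l) * causalSum q o x a k (H ++ [⟨l, (a l, x l)⟩])
        else 0

end CIQ

end


open CIQ CIQ.Protocol

set_option linter.unusedSectionVars false

namespace CIQ

open Matrix

variable {N T : ℕ} {S : Type} [Fintype S] [DecidableEq S]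
variable {A : Fin N → Type} [∀ i, Fintype (A i)] [∀ i, DecidableEq (A i)]
variable {X : Fin N → Type} [∀ i, Fintype (X i)] [∀ i, DecidableEq (X i)]

/-- An operator acting on system and control acts fibrewise over results and flags. -/
theorem extSC_mulVec_apply (M : Matrix (S × Fin (N + 1)) (S × Fin (N + 1)) ℂ)
    (v : Idx N T S A → ℂ) (s : S) (c : Fin (N + 1))
    (k : ((i : Fin N) → A i) × ((i : Fin N) → Fin (T + 1))) :
    (extSC M *ᵥ v) (s, c, k) = (M *ᵥ fun y => v (y.1, y.2, k)) (s, c) := by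
  simp only [mulVec, dotProduct, extSC]
  symm
  refine Finset.sum_of_injOn (fun y : S × Fin (N + 1) => (y.1, y.2, k)) ?_ ?_ ?_ ?_
  · rintro ⟨a, b⟩ - ⟨a', b'⟩ - h
    simp only [Prod.mk.injEq] at h
    simp [h.1, h.2.1]
  · simp
  · rintro ⟨a, b, k'⟩ - h
    have hk : k ≠ k' := by
      rintro rfl
      exact h ⟨(a, b), by simp, rfl⟩
    simp [hk]
  · simp

theorem sum_normSq_unitary {ι : Type*} [Fintype ι] [DecidableEq ι] {M : Matrix ι ι ℂ}
    (hM : M ∈ unitaryGroup ι ℂ) (w : ι → ℂ) :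
    ∑ i, Complex.normSq ((M *ᵥ w) i) = ∑ i, Complex.normSq (w i) := by
  have key (u : ι → ℂ) : star u ⬝ᵥ u = ((∑ i, Complex.normSq (u i) : ℝ) : ℂ) := by
    simp only [dotProduct, Pi.star_apply, RCLike.star_def, Complex.ofReal_sum,
      Complex.normSq_eq_conj_mul_self]
  have h : star (M *ᵥ w) ⬝ᵥ (M *ᵥ w) = star w ⬝ᵥ w := by
    rw [star_mulVec, ← dotProduct_mulVec, mulVec_mulVec, ← star_eq_conjTranspose,
      mem_unitaryGroup_iff'.1 hM, one_mulVec]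
  rw [key, key] at h
  exact_mod_cast h

theorem eq_zero_of_unitary_mulVec {ι : Type*} [Fintype ι] [DecidableEq ι] {M : Matrix ι ι ℂ}
    (hM : M ∈ unitaryGroup ι ℂ) {w : ι → ℂ} (h : M *ᵥ w = 0) : w = 0 := by
  rw [← one_mulVec w, ← mem_unitaryGroup_iff'.1 hM, ← mulVec_mulVec, h, mulVec_zero]

/-- Squared norm of the component of `v` selected by `π^H_{rf}`. -/
def histWeight (H : Hist N A X) (v : Idx N T S A → ℂ) : ℝ :=
  ∑ p, if histSat H p.2.2.1 p.2.2.2 then Complex.normSq (v p) else 0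

/-- Squared norm of the component of `v` selected by `|c⟩⟨c| ⊗ π^H_{rf}`. -/
def histCtrlWeight (H : Hist N A X) (v : Idx N T S A → ℂ) (c : Fin (N + 1)) : ℝ :=
  ∑ p, if p.2.1 = c ∧ histSat H p.2.2.1 p.2.2.2 then Complex.normSq (v p) else 0

theorem histWeight_eq_add_sum (H : Hist N A X) (v : Idx N T S A → ℂ) :
    histWeight H v = histCtrlWeight H v 0 + ∑ l : Fin N, histCtrlWeight H v l.succ := by
  rw [← Fin.sum_univ_succ (fun c => histCtrlWeight H v c)]
  simp only [histWeight, histCtrlWeight]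
  rw [Finset.sum_comm]
  refine Finset.sum_congr rfl fun p _ => ?_
  simp [ite_and]

theorem histWeight_extSC {M : Matrix (S × Fin (N + 1)) (S × Fin (N + 1)) ℂ}
    (hM : M ∈ unitaryGroup (S × Fin (N + 1)) ℂ) (H : Hist N A X) (v : Idx N T S A → ℂ) :
    histWeight H (extSC M *ᵥ v) = histWeight H v := by
  have split (u : Idx N T S A → ℂ) : histWeight H u =
      ∑ k : ((i : Fin N) → A i) × ((i : Fin N) → Fin (T + 1)),
        if histSat H k.1 k.2 then ∑ y : S × Fin (N + 1), Complex.normSq (u (y.1, y.2, k))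
        else 0 := by
    simp only [histWeight]
    rw [← (Equiv.prodAssoc S (Fin (N + 1)) _).sum_comp, Fintype.sum_prod_type_right]
    refine Finset.sum_congr rfl fun k _ => ?_
    by_cases hk : histSat H k.1 k.2 <;> simp [hk]
  rw [split, split]
  refine Finset.sum_congr rfl fun k _ => ?_
  simp only [extSC_mulVec_apply]
  exact if_congr Iff.rfl (sum_normSq_unitary hM fun y => v (y.1, y.2, k)) rfl

theorem histWeight_eq_zero {H : Hist N A X} {v : Idx N T S A → ℂ}
    (h : ∀ p, histSat H p.2.2.1 p.2.2.2 → v p = 0) : histWeight H v = 0 :=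
  Finset.sum_eq_zero fun p _ => by
    split_ifs with hp
    · rw [h p hp, map_zero]
    · rfl

namespace Protocol

variable (P : Protocol N T S A X) (x : ∀ l, X l)

theorem nsq_psi (c : Fin (N + 1)) (t : ℕ) (H : Hist N A X) :
    nsq (P.psi x c t H) = histCtrlWeight H (P.pre x t *ᵥ P.ket0) c := by
  simp only [nsq, psi, histCtrlWeight]
  refine Finset.sum_congr rfl fun p _ => ?_
  split_ifs <;> simp

theorem pre_succ_mulVec (t : ℕ) (v : Idx N T S A → ℂ) :
    P.pre x (t + 1) *ᵥ v = extSC (P.U (t + 1)) *ᵥ (P.chain x t *ᵥ v) := by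
  rw [mulVec_mulVec]; rfl

theorem chain_succ_mulVec (t : ℕ) (v : Idx N T S A → ℂ) :
    P.chain x (t + 1) *ᵥ v = P.Vmat x *ᵥ (P.pre x (t + 1) *ᵥ v) := by
  rw [mulVec_mulVec]; rfl

theorem Vmat_zero_mulVec_apply (v : Idx N T S A → ℂ) {p : Idx N T S A} (hp : p.2.1 = 0) :
    (P.Vmat x *ᵥ v) p = v p := by
  simp [mulVec, dotProduct, Vmat, hp]

theorem Vmat_succ_apply {p q : Idx N T S A} {l : Fin N} (hp : p.2.1 = l.succ) :
    P.Vmat x p q = if q.2.1 = l.succ ∧ (∀ i, i ≠ l → q.2.2.1 i = p.2.2.1 i)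
        ∧ (∀ i, i ≠ l → q.2.2.2 i = p.2.2.2 i) ∧ q.2.2.2 l + 1 = p.2.2.2 l then
      P.Vm l (x l) (p.1, p.2.2.1 l) (q.1, q.2.2.1 l) else 0 := by
  obtain ⟨s, c, r, f⟩ := p
  obtain rfl : c = l.succ := hp
  have h : l.succ ≠ 0 := Fin.succ_ne_zero l
  rw [Vmat, dif_neg h]
  dsimp only
  generalize hm : l.succ.pred h = m
  obtain rfl : m = l := by rw [← hm, Fin.pred_succ]
  rfl

theorem Vmat_succ_mulVec_apply (v : Idx N T S A → ℂ) (l : Fin N) (s : S) (r : ∀ i, A i)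
    (f : (i : Fin N) → Fin (T + 1)) :
    (P.Vmat x *ᵥ v) (s, l.succ, r, Function.update f l (f l + 1)) =
      (P.Vm l (x l) *ᵥ fun y => v (y.1, l.succ, Function.update r l y.2, f)) (s, r l) := by
  simp only [mulVec, dotProduct]
  symm
  refine Finset.sum_of_injOn
    (fun y : S × A l => (y.1, l.succ, Function.update r l y.2, f)) ?_ ?_ ?_ ?_
  · rintro ⟨a, b⟩ - ⟨a', b'⟩ - h
    simp only [Prod.mk.injEq] at h
    have := congrFun h.2.2.1 l
    simp only [Function.update_self] at this
    simp [h.1, this]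
  · simp
  · rintro ⟨a, c, r', f'⟩ - h
    rw [P.Vmat_succ_apply x rfl, if_neg, zero_mul]
    rintro ⟨h1, h2, h3, h4⟩
    refine h ⟨(a, r' l), by simp, ?_⟩
    simp only [Prod.mk.injEq, true_and]
    refine ⟨h1.symm, ?_, ?_⟩
    · funext i
      by_cases hi : i = l
      · subst hi; simp
      · simpa [hi] using (h2 i hi).symm
    · funext i
      by_cases hi : i = l
      · subst hi; simpa using h4.symm
      · simpa [hi] using (h3 i hi).symm
  · rintro ⟨a, b⟩ -
    rw [P.Vmat_succ_apply x rfl, if_pos]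
    · simp
    · refine ⟨rfl, fun i hi => ?_, fun i hi => ?_, ?_⟩ <;> simp [*]

variable {P x}

/-- A nonzero amplitude after `V` with control on lab `l` comes from a nonzero amplitude whose
flag `l` is one lower, all other flags being unchanged. -/
theorem exists_of_Vmat_succ_mulVec_ne_zero {v : Idx N T S A → ℂ} {p : Idx N T S A} {l : Fin N}
    (hp : p.2.1 = l.succ) (h : (P.Vmat x *ᵥ v) p ≠ 0) :
    ∃ q, v q ≠ 0 ∧ (∀ i, i ≠ l → q.2.2.2 i = p.2.2.2 i) ∧ q.2.2.2 l + 1 = p.2.2.2 l := by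
  obtain ⟨q, -, hq⟩ := Finset.exists_ne_zero_of_sum_ne_zero h
  change P.Vmat x p q * v q ≠ 0 at hq
  rw [P.Vmat_succ_apply x hp] at hq
  split_ifs at hq with hc
  · exact ⟨q, right_ne_zero_of_mul hq, hc.2.2.1, hc.2.2.2⟩
  · simp at hq

theorem eq_zero_of_Vmat_succ_mulVec (hVm : P.unitaryVm) {v : Idx N T S A → ℂ} {l : Fin N}
    {f : (i : Fin N) → Fin (T + 1)}
    (h : ∀ s r, (P.Vmat x *ᵥ v) (s, l.succ, r, Function.update f l (f l + 1)) = 0)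
    (s : S) (r : ∀ i, A i) : v (s, l.succ, r, f) = 0 := by
  have h0 : (P.Vm l (x l) *ᵥ fun y => v (y.1, l.succ, Function.update r l y.2, f)) = 0 := by
    funext ⟨a, b⟩
    have := h a (Function.update r l b)
    rw [P.Vmat_succ_mulVec_apply x] at this
    simpa using this
  simpa using congrFun (eq_zero_of_unitary_mulVec (hVm l (x l)) h0) (s, r l)

theorem eq_zero_of_extSC_mulVec {M : Matrix (S × Fin (N + 1)) (S × Fin (N + 1)) ℂ}
    (hM : M ∈ unitaryGroup (S × Fin (N + 1)) ℂ) {v : Idx N T S A → ℂ}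
    {k : ((i : Fin N) → A i) × ((i : Fin N) → Fin (T + 1))}
    (h : ∀ s c, (extSC M *ᵥ v) (s, c, k) = 0) (s : S) (c : Fin (N + 1)) : v (s, c, k) = 0 := by
  have h0 : (M *ᵥ fun y => v (y.1, y.2, k)) = 0 := by
    funext ⟨a, b⟩
    simpa [extSC_mulVec_apply] using h a b
  exact congrFun (eq_zero_of_unitary_mulVec hM h0) (s, c)

theorem flag_le_of_extSC_mulVec {M : Matrix (S × Fin (N + 1)) (S × Fin (N + 1)) ℂ}
    {v : Idx N T S A → ℂ} {t : ℕ} (hv : ∀ p, v p ≠ 0 → ∀ i, (p.2.2.2 i : ℕ) ≤ t)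
    (p : Idx N T S A) (hp : (extSC M *ᵥ v) p ≠ 0) (i : Fin N) : (p.2.2.2 i : ℕ) ≤ t := by
  obtain ⟨s, c, k⟩ := p
  rw [extSC_mulVec_apply] at hp
  obtain ⟨y, -, hy⟩ := Finset.exists_ne_zero_of_sum_ne_zero hp
  exact hv _ (right_ne_zero_of_mul hy) i

variable (P x)

/-- After `t` activations every flag is at most `t`. -/
theorem flag_le_of_chain_ne_zero (t : ℕ) :
    ∀ p, (P.chain x t *ᵥ P.ket0) p ≠ 0 → ∀ i, (p.2.2.2 i : ℕ) ≤ t := by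
  induction t with
  | zero =>
    intro p hp i
    simp only [chain, one_mulVec, ket0, ne_eq, ite_eq_right_iff, one_ne_zero, imp_false,
      not_not] at hp
    simp [hp]
  | succ t ih =>
    intro p hp i
    rw [chain_succ_mulVec, pre_succ_mulVec] at hp
    obtain hc | ⟨l, hc⟩ := Fin.eq_zero_or_eq_succ p.2.1
    · rw [P.Vmat_zero_mulVec_apply x _ hc] at hp
      exact (flag_le_of_extSC_mulVec ih p hp i).trans t.le_succ
    · obtain ⟨q, hq, h1, h2⟩ := exists_of_Vmat_succ_mulVec_ne_zero hc hp
      have hqi := flag_le_of_extSC_mulVec ih q hq i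
      by_cases hi : i = l
      · subst hi
        rw [← h2, Fin.val_add_one]
        split_ifs <;> omega
      · rw [← h1 i hi]; omega

theorem flag_le_of_pre_ne_zero (t : ℕ) (p : Idx N T S A)
    (hp : (P.pre x (t + 1) *ᵥ P.ket0) p ≠ 0) (i : Fin N) : (p.2.2.2 i : ℕ) ≤ t := by
  rw [pre_succ_mulVec] at hp
  exact flag_le_of_extSC_mulVec (P.flag_le_of_chain_ne_zero x t) p hp i

variable {P x}

/-- If flag `l` never exceeds `1` after an activation, then just before that activation there is
no amplitude that would push it above `1`. -/
theorem pre_eq_zero_of_flag (hVm : P.unitaryVm) {l : Fin N} {t : ℕ} (ht : t < T)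
    (h : ∀ p, 2 ≤ (p.2.2.2 l : ℕ) → (P.chain x (t + 1) *ᵥ P.ket0) p = 0)
    (p : Idx N T S A)
    (hp : 2 ≤ (p.2.2.2 l : ℕ) ∨ p.2.1 = l.succ ∧ 1 ≤ (p.2.2.2 l : ℕ)) :
    (P.pre x (t + 1) *ᵥ P.ket0) p = 0 := by
  by_contra hne
  have hle := P.flag_le_of_pre_ne_zero x t p hne
  rw [chain_succ_mulVec] at h
  obtain ⟨s, c, r, f⟩ := p
  obtain rfl | ⟨m, rfl⟩ := Fin.eq_zero_or_eq_succ c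
  · exact hne <| (P.Vmat_zero_mulVec_apply x _ rfl).symm.trans <| h _ (hp.resolve_right fun h' => Fin.succ_ne_zero l h'.1.symm)
  · refine hne (eq_zero_of_Vmat_succ_mulVec (x := x) hVm (fun s' r' => h _ ?_) s r)
    dsimp only at hp hle ⊢
    by_cases hm : m = l
    · subst hm
      have := hle m
      rw [Function.update_self, Fin.val_add_one_of_lt' (by omega)]
      omega
    · rw [Function.update_of_ne (Ne.symm hm)]
      exact hp.resolve_right fun h' => hm (Fin.succ_injective _ h'.1)

theorem chain_eq_zero_of_flag (hT : 2 ≤ T) (hVm : P.unitaryVm) (hU : P.unitaryU)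
    (hflag : P.flagOK x) {l : Fin N} {t : ℕ} (ht : t ≤ T) :
    ∀ p, 2 ≤ (p.2.2.2 l : ℕ) → (P.chain x t *ᵥ P.ket0) p = 0 := by
  induction ht using Nat.decreasingInduction with
  | self =>
    intro p hp
    by_contra hne
    rw [hflag p hne l, Fin.val_one', Nat.mod_eq_of_lt (by omega)] at hp
    omega
  | of_succ t ht ih =>
    rintro ⟨s, c, k⟩ hp
    refine eq_zero_of_extSC_mulVec (hU (t + 1) (by omega) ht) (fun s' c' => ?_) s c
    rw [← pre_succ_mulVec]
    exact pre_eq_zero_of_flag hVm ht ih _ (Or.inl hp)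

/-- A lab already in the history is never about to act again. -/
theorem histCtrlWeight_pre_eq_zero (hT : 2 ≤ T) (hVm : P.unitaryVm) (hU : P.unitaryU)
    (hflag : P.flagOK x) {H : Hist N A X} {e : (l : Fin N) × (A l × X l)} (he : e ∈ H)
    {t : ℕ} (ht : t < T) :
    histCtrlWeight H (P.pre x (t + 1) *ᵥ P.ket0) e.1.succ = 0 := by
  refine Finset.sum_eq_zero fun p _ => ?_
  split_ifs with hp
  · rw [pre_eq_zero_of_flag (l := e.1) hVm ht (chain_eq_zero_of_flag hT hVm hU hflag ht) p
      (Or.inr ⟨hp.1, ?_⟩), map_zero]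
    rw [(hp.2.1 e he).2, Fin.val_one', Nat.mod_eq_of_lt (by omega)]
  · rfl

/-- A lab whose flag reads `0` has not just acted. -/
theorem histCtrlWeight_chain_eq_zero {H : Hist N A X} {l : Fin N} (hl : ∀ e ∈ H, e.1 ≠ l)
    {t : ℕ} (ht : t < T) :
    histCtrlWeight H (P.chain x (t + 1) *ᵥ P.ket0) l.succ = 0 := by
  refine Finset.sum_eq_zero fun p _ => ?_
  split_ifs with hp
  · rw [map_eq_zero, chain_succ_mulVec]
    by_contra hne
    obtain ⟨q, hq, -, h2⟩ := exists_of_Vmat_succ_mulVec_ne_zero hp.1 hne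
    have hle := P.flag_le_of_pre_ne_zero x t q hq l
    rw [hp.2.2 l hl] at h2
    have := congrArg Fin.val h2
    rw [Fin.val_add_one_of_lt' (by omega)] at this
    simp at this
  · rfl

theorem histSat_filter_iff {H : Hist N A X} (hH : labsDistinct H)
    {e : (l : Fin N) × (A l × X l)} (he : e ∈ H) {r r' : ∀ i, A i}
    {f f' : (i : Fin N) → Fin (T + 1)} (hr : ∀ i, i ≠ e.1 → r' i = r i)
    (hf : ∀ i, i ≠ e.1 → f' i = f i) (hfe : f' e.1 + 1 = f e.1) (hre : r e.1 = e.2.1) :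
    histSat (H.filter fun d => decide (d.1 ≠ e.1)) r' f' ↔ histSat H r f := by
  have huniq : ∀ d ∈ H, d.1 = e.1 → d = e := fun d hd h =>
    List.inj_on_of_nodup_map hH hd he h
  simp only [histSat, List.mem_filter, decide_eq_true_eq]
  constructor
  · rintro ⟨h1, h2⟩
    refine ⟨fun d hd => ?_, fun i hi => ?_⟩
    · by_cases hde : d.1 = e.1
      · rw [huniq d hd hde, ← hfe, h2 e.1 fun d hd => hd.2]
        exact ⟨hre, zero_add 1⟩
      · rw [← hr _ hde, ← hf _ hde]
        exact h1 d ⟨hd, hde⟩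
    · rw [← hf i (hi e he).symm]
      exact h2 i fun d hd => hi d hd.1
  · rintro ⟨h1, h2⟩
    refine ⟨fun d hd => ?_, fun i hi => ?_⟩
    · rw [hr _ hd.2, hf _ hd.2]
      exact h1 d hd.1
    · by_cases hie : i = e.1
      · subst hie
        rw [(h1 e he).2] at hfe
        simpa using hfe
      · rw [hf i hie]
        exact h2 i fun d hd hdi => hi d ⟨hd, hdi ▸ hie⟩ hdi

/-- `|φ_{(l,t,H)}⟩` is the component of the evolved state with control `l` and history `H`. -/
theorem nsq_phiFull {H : Hist N A X} (hH : labsDistinct H)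
    {e : (l : Fin N) × (A l × X l)} (he : e ∈ H) (t : ℕ) :
    nsq (P.phiFull x e.1 e.2.1 (t + 1) H) =
      histCtrlWeight H (P.chain x (t + 1) *ᵥ P.ket0) e.1.succ := by
  simp only [nsq, histCtrlWeight]
  refine Finset.sum_congr rfl fun p _ => ?_
  rw [← map_zero Complex.normSq, ← apply_ite Complex.normSq]
  congr 1
  rw [chain_succ_mulVec]
  simp only [phiFull, phiOf]
  by_cases hre : p.2.2.1 e.1 = e.2.1
  swap
  · rw [if_neg hre, if_neg fun h => hre (h.2.1 e he).1]
  rw [if_pos hre]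
  obtain hc | ⟨m, hc⟩ := Fin.eq_zero_or_eq_succ p.2.1
  · rw [P.Vmat_zero_mulVec_apply x _ hc, psi, hc, if_neg fun h => Fin.succ_ne_zero _ h.1.symm,
      if_neg fun h => Fin.succ_ne_zero _ h.1.symm]
  by_cases hm : m = e.1
  · subst hm
    have key (q : Idx N T S A) : P.Vmat x p q *
        P.psi x e.1.succ (t + 1) (H.filter fun d => decide (d.1 ≠ e.1)) q =
        if histSat H p.2.2.1 p.2.2.2 then
          P.Vmat x p q * (P.pre x (t + 1) *ᵥ P.ket0) q else 0 := by
      rw [P.Vmat_succ_apply x hc]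
      split_ifs with hq hp hp
      · rw [psi, if_pos ⟨hq.1, (histSat_filter_iff hH he hq.2.1 hq.2.2.1 hq.2.2.2 hre).2 hp⟩]
      · rw [psi, if_neg fun h => hp
          ((histSat_filter_iff hH he hq.2.1 hq.2.2.1 hq.2.2.2 hre).1 h.2), mul_zero]
      · simp
      · simp
    rw [show ∀ v, (P.Vmat x *ᵥ v) p = ∑ q, P.Vmat x p q * v q from fun v => rfl,
      Finset.sum_congr rfl fun q _ => key q]
    simp only [hc, true_and]
    split_ifs
    · rfl
    · simp
  · rw [if_neg fun h => hm (Fin.succ_injective _ (hc ▸ h.1))]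
    refine Finset.sum_eq_zero fun q _ => ?_
    change P.Vmat x p q * _ = 0
    rw [P.Vmat_succ_apply x hc]
    split_ifs with hq
    · rw [psi, if_neg fun h => hm (Fin.succ_injective _ (hq.1 ▸ h.1)), mul_zero]
    · rw [zero_mul]

/-- The weight on history `H` gained in one time step is the weight of the labs in `H` that have
just acted, minus that of the other labs that are about to act. -/
theorem histWeight_chain_succ_sub (hT : 2 ≤ T) (hVm : P.unitaryVm) (hU : P.unitaryU)
    (hflag : P.flagOK x) {H : Hist N A X} (hH : labsDistinct H)
    {t : ℕ} (ht : t < T) :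
    histWeight H (P.chain x (t + 1) *ᵥ P.ket0) - histWeight H (P.chain x t *ᵥ P.ket0) =
      ∑ e ∈ H.toFinset, nsq (P.phiFull x e.1 e.2.1 (t + 1) H)
        - ∑ l ∈ Finset.univ.filter (fun l : Fin N => ∀ e ∈ H, e.1 ≠ l),
            nsq (P.psi x l.succ (t + 1) H) := by
  have hafter : ∑ l : Fin N, histCtrlWeight H (P.chain x (t + 1) *ᵥ P.ket0) l.succ =
      ∑ e ∈ H.toFinset, nsq (P.phiFull x e.1 e.2.1 (t + 1) H) := by
    rw [Finset.sum_congr rfl fun e he => nsq_phiFull hH (List.mem_toFinset.1 he) t]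
    symm
    refine Finset.sum_of_injOn Sigma.fst ?_ (by simp) ?_ (fun _ _ => rfl)
    · intro d hd e he h
      exact List.inj_on_of_nodup_map hH (by simpa using hd) (by simpa using he) h
    · intro l _ hl
      exact histCtrlWeight_chain_eq_zero
        (fun e he hel => hl ⟨e, by simpa using he, hel⟩) ht
  have hbefore : ∑ l : Fin N, histCtrlWeight H (P.pre x (t + 1) *ᵥ P.ket0) l.succ =
      ∑ l ∈ Finset.univ.filter (fun l : Fin N => ∀ e ∈ H, e.1 ≠ l),
        nsq (P.psi x l.succ (t + 1) H) := by
    simp only [nsq_psi]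
    symm
    refine Finset.sum_subset (Finset.subset_univ _) fun l _ hl => ?_
    simp only [Finset.mem_filter, Finset.mem_univ, true_and, not_forall, not_not] at hl
    obtain ⟨e, he, rfl⟩ := hl
    exact histCtrlWeight_pre_eq_zero hT hVm hU hflag he ht
  have hzero : histCtrlWeight H (P.chain x (t + 1) *ᵥ P.ket0) 0 =
      histCtrlWeight H (P.pre x (t + 1) *ᵥ P.ket0) 0 := by
    refine Finset.sum_congr rfl fun p _ => ?_
    split_ifs with hp
    · rw [chain_succ_mulVec, P.Vmat_zero_mulVec_apply x _ hp.1]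
    · rfl
  rw [← histWeight_extSC (hU (t + 1) (by omega) ht) H (P.chain x t *ᵥ P.ket0),
    ← pre_succ_mulVec, histWeight_eq_add_sum, histWeight_eq_add_sum H (P.pre x (t + 1) *ᵥ P.ket0),
    hafter, hbefore, hzero]
  ring

end Protocol

end CIQ

/-- **Result 4**: under the flag constraint, for every `1 ≤ k < N` and history
`H_k` with `k` distinct labs,
`Σ_(l ∈ ℒ_k) Σ_(t=1)^T ‖φ_(l,t,H_k)‖² = Σ_(l' ∉ ℒ_k) Σ_(t'=1)^T ‖ψ_(l',t',H_k)‖²`. -/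
theorem result_four
    (N T : ℕ) (S : Type) [Fintype S] [DecidableEq S]
    (A : Fin N → Type) [∀ i, Fintype (A i)] [∀ i, DecidableEq (A i)]
    (X : Fin N → Type) [∀ i, Fintype (X i)] [∀ i, DecidableEq (X i)]
    (hN : 1 ≤ N) (hT : N ≤ T)
    (P : Protocol N T S A X) (hVm : P.unitaryVm) (hU : P.unitaryU)
    (x : ∀ l, X l) (hflag : P.flagOK x)
    (H : Hist N A X) (hH : labsDistinct H) (hne : H ≠ []) (hlen : H.length < N) :
    ∑ e ∈ H.toFinset, ∑ t ∈ Finset.Icc 1 T, nsq (P.phiFull x e.1 e.2.1 t H)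
      = ∑ l ∈ Finset.univ.filter (fun l : Fin N => ∀ e ∈ H, e.1 ≠ l),
          ∑ t ∈ Finset.Icc 1 T, nsq (P.psi x l.succ t H) := by
  have hT2 : 2 ≤ T := by
    have := List.length_pos_iff.2 hne
    omega
  have h10 : (1 : Fin (T + 1)) ≠ 0 := by
    rw [Ne, Fin.ext_iff, Fin.val_one', Nat.mod_eq_of_lt (by omega)]
    simp
  obtain ⟨e₀, he₀⟩ := List.exists_mem_of_ne_nil H hne
  obtain ⟨l₀, hl₀⟩ : ∃ l : Fin N, ∀ e ∈ H, e.1 ≠ l := by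
    by_contra! hcon
    have hsub : (Finset.univ : Finset (Fin N)) ⊆ (H.map Sigma.fst).toFinset := fun l _ => by
      obtain ⟨e, he, hel⟩ := hcon l
      exact List.mem_toFinset.2 (List.mem_map.2 ⟨e, he, hel⟩)
    have h1 := (Finset.card_le_card hsub).trans (List.toFinset_card_le _)
    rw [Finset.card_univ, Fintype.card_fin, List.length_map] at h1
    omega
  let W : ℕ → ℝ := fun t => histWeight H ((P.chain x t).mulVec P.ket0)
  have hW0 : W 0 = 0 := histWeight_eq_zero fun p hp => by
    simp only [chain, Matrix.one_mulVec, ket0, ite_eq_right_iff]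
    rintro rfl
    exact absurd (hp.1 e₀ he₀).2.symm h10
  have hWT : W T = 0 := histWeight_eq_zero fun p hp => by
    by_contra hne'
    exact h10 ((hflag p hne' l₀).symm.trans (hp.2 l₀ hl₀))
  have step (t : ℕ) (ht : t < T) : W (t + 1) - W t =
      ∑ e ∈ H.toFinset, nsq (P.phiFull x e.1 e.2.1 (t + 1) H)
        - ∑ l ∈ Finset.univ.filter (fun l : Fin N => ∀ e ∈ H, e.1 ≠ l),
            nsq (P.psi x l.succ (t + 1) H) :=
    histWeight_chain_succ_sub hT2 hVm hU hflag hH ht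
  have hsum : ∑ t ∈ Finset.range T, (W (t + 1) - W t) = 0 := by
    rw [Finset.sum_range_sub, hW0, hWT, sub_zero]
  rw [Finset.sum_congr rfl fun t ht => step t (Finset.mem_range.1 ht),
    Finset.sum_sub_distrib, sub_eq_zero] at hsum
  have hIcc (F : ℕ → ℝ) : ∑ t ∈ Finset.Icc 1 T, F t = ∑ t ∈ Finset.range T, F (t + 1) := by
    rw [Finset.range_eq_Ico, Finset.sum_Ico_add' F 0 T 1]
    rfl
  simp only [hIcc]
  rw [Finset.sum_comm, hsum, Finset.sum_comm]
end

section
/- Boundary vanishing: under the flag constraint, (i) for every history H_k with k < N distinct labs (including the empty history), ψ̄_{(0,T,H_k)} = 0; (ii) for every history H_k with k < N distinct labs and every l ∈ ℒ_k, φ̄_{(l,T,H_k)} = φ_{(l,T,H_k)} = 0; (iii) for every nonempty history H_k (k ≥ 1) and every l ∈ {0,1,…,N}, ψ_{(l,1,H_k)} = 0; (iv) if N ≥ 2, then for every complete history H_N containing all N labs, φ̄_{(0,1,H_N)} = 0. -/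
open CIQ CIQ.Protocol

namespace CIQ

section

variable {N T : ℕ} {S : Type} {A X : Fin N → Type}

/-- A history shorter than the number of labs misses some lab. -/
lemma exists_lab_not_mem (H : Hist N A X) (hH : H.length < N) :
    ∃ i : Fin N, ∀ e ∈ H, e.1 ≠ i := by
  by_contra! h
  have hsub : (Finset.univ : Finset (Fin N)) ⊆ (H.map Sigma.fst).toFinset := by
    intro i _
    obtain ⟨e, he, rfl⟩ := h i
    exact List.mem_toFinset.2 (List.mem_map_of_mem he)
  have h1 := Finset.card_le_card hsub
  have h2 := (H.map Sigma.fst).toFinset_card_le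
  rw [Finset.card_univ, Fintype.card_fin] at h1
  rw [List.length_map] at h2
  omega

namespace Protocol

variable [DecidableEq S] [∀ i, DecidableEq (A i)]
variable (P : Protocol N T S A X) (x : ∀ l, X l)

/-- The lab-activation unitary preserves the control value. -/
lemma control_eq_of_Vmat_ne_zero {p q : Idx N T S A} (h : P.Vmat x p q ≠ 0) :
    q.2.1 = p.2.1 := by
  unfold Vmat at h
  split_ifs at h with h0 h1 h1
  · rw [h1]
  · exact absurd rfl h
  · exact h1.1
  · exact absurd rfl h

/-- Activating lab `l` leaves the other result registers and flags unchanged and raises the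
flag of `l`. -/
lemma registers_of_Vmat_ne_zero {p q : Idx N T S A} {l : Fin N} (hp : p.2.1 = l.succ)
    (h : P.Vmat x p q ≠ 0) :
    (∀ i, i ≠ l → q.2.2.1 i = p.2.2.1 i) ∧ (∀ i, i ≠ l → q.2.2.2 i = p.2.2.2 i) ∧
      q.2.2.2 l + 1 = p.2.2.2 l := by
  obtain ⟨s, c, r, f⟩ := p
  obtain rfl : c = l.succ := hp
  simp only [Vmat, Fin.succ_ne_zero, dite_false, Fin.pred_succ] at h
  split_ifs at h with h1
  · exact h1.2
  · exact absurd rfl h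

/-- For a history without lab `l`, whether a state satisfies it before the activation of `l`
can be read off after that activation. -/
lemma histSat_iff_of_Vmat_ne_zero {p q q' : Idx N T S A} {l : Fin N} (hp : p.2.1 = l.succ)
    (H : Hist N A X) (hl : ∀ e ∈ H, e.1 ≠ l)
    (h : P.Vmat x p q ≠ 0) (h' : P.Vmat x p q' ≠ 0)
    (hs : histSat H q.2.2.1 q.2.2.2) : histSat H q'.2.2.1 q'.2.2.2 := by
  obtain ⟨hr, hf, hfl⟩ := registers_of_Vmat_ne_zero P x hp h
  obtain ⟨hr', hf', hfl'⟩ := registers_of_Vmat_ne_zero P x hp h'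
  have hff : q'.2.2.2 = q.2.2.2 := by
    funext i
    by_cases hi : i = l
    · subst hi
      exact add_right_cancel (hfl'.trans hfl.symm)
    · rw [hf i hi, hf' i hi]
  rw [hff]
  refine ⟨fun e he => ⟨?_, (hs.1 e he).2⟩, hs.2⟩
  rw [hr' _ (hl e he), ← hr _ (hl e he)]
  exact (hs.1 e he).1

variable [Fintype S] [∀ i, Fintype (A i)]

/-- The lab-activation unitary is the identity on the control value `0`. -/
lemma Vmat_mulVec_of_control_zero (v : Idx N T S A → ℂ) (p : Idx N T S A) (hp : p.2.1 = 0) :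
    (P.Vmat x).mulVec v p = v p := by
  simp [Matrix.mulVec, dotProduct, Vmat, hp]

lemma Uop_eq_Vmat_mul_pre (hT : 1 ≤ T) : P.Uop x = P.Vmat x * P.pre x T := by
  obtain ⟨t, rfl⟩ : ∃ t, T = t + 1 := ⟨T - 1, by omega⟩
  rfl

/-- The flag constraint, applied to the state just before the last activation. -/
lemma flagOK.flag_eq_one {P : Protocol N T S A X} {x : ∀ l, X l} (hflag : P.flagOK x)
    (hT : 1 ≤ T) {p : Idx N T S A}
    (hp : (P.Vmat x).mulVec ((P.pre x T).mulVec P.ket0) p ≠ 0) (i : Fin N) :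
    p.2.2.2 i = 1 := by
  refine hflag p ?_ i
  rwa [Uop_eq_Vmat_mul_pre P x hT, ← Matrix.mulVec_mulVec]

variable [∀ i, Fintype (X i)] [∀ i, DecidableEq (X i)]

/-- Before the last activation no idle branch has a lab that is yet to act. -/
lemma flagOK.psi_zero_eq_zero {P : Protocol N T S A X} {x : ∀ l, X l} (hflag : P.flagOK x)
    (hT : 1 ≤ T) (H : Hist N A X) (hH : H.length < N) : P.psi x 0 T H = 0 := by
  funext p
  obtain ⟨i, hi⟩ := exists_lab_not_mem H hH
  simp only [psi, Pi.zero_apply, ite_eq_right_iff]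
  rintro ⟨hc, hs⟩
  by_contra hne
  have h1 := hflag.flag_eq_one hT (p := p)
    (by rwa [Vmat_mulVec_of_control_zero P x _ p hc]) i
  rw [hs.2 i hi] at h1
  have := congrArg Fin.val h1
  rw [Fin.val_zero, Fin.val_one', Nat.mod_eq_of_lt (by omega)] at this
  omega

/-- After the last activation no just-measured branch has a lab that is yet to act. -/
lemma flagOK.phiOf_eq_zero {P : Protocol N T S A X} {x : ∀ l, X l} (hflag : P.flagOK x)
    (hT : 1 ≤ T) (H : Hist N A X) (l : Fin N) (a : A l) (hl : ∀ e ∈ H, e.1 ≠ l)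
    {i : Fin N} (hil : i ≠ l) (hi : ∀ e ∈ H, e.1 ≠ i) : P.phiOf x l a T H = 0 := by
  funext p
  simp only [phiOf, Pi.zero_apply, ite_eq_right_iff]
  intro _
  by_contra hne
  obtain ⟨q, -, hq⟩ := Finset.exists_ne_zero_of_sum_ne_zero hne
  have hV : P.Vmat x p q ≠ 0 := left_ne_zero_of_mul hq
  obtain ⟨hqc, hqs⟩ : q.2.1 = l.succ ∧ histSat H q.2.2.1 q.2.2.2 := by
    by_contra hcon
    exact right_ne_zero_of_mul hq (if_neg hcon)
  have hpc : p.2.1 = l.succ := (control_eq_of_Vmat_ne_zero P x hV).symm.trans hqc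
  have heq : (P.Vmat x).mulVec (P.psi x l.succ T H) p =
      (P.Vmat x).mulVec ((P.pre x T).mulVec P.ket0) p := by
    refine Finset.sum_congr rfl fun q' _ => ?_
    change P.Vmat x p q' * _ = P.Vmat x p q' * _
    by_cases hV' : P.Vmat x p q' = 0
    · rw [hV', zero_mul, zero_mul]
    · have hcond : q'.2.1 = l.succ ∧ histSat H q'.2.2.1 q'.2.2.2 :=
        ⟨(control_eq_of_Vmat_ne_zero P x hV').trans hpc,
          histSat_iff_of_Vmat_ne_zero P x hpc H hl hV hV' hqs⟩
      rw [psi, if_pos hcond]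
  have h1 := hflag.flag_eq_one hT (p := p) (by rwa [← heq]) i
  rw [← (registers_of_Vmat_ne_zero P x hpc hV).2.1 i hil, hqs.2 i hi] at h1
  have := congrArg Fin.val h1
  rw [Fin.val_zero, Fin.val_one', Nat.mod_eq_of_lt (by omega)] at this
  omega

/-- Before the first activation no lab has acted. -/
lemma psi_one_eq_zero (hT : 1 ≤ T) (H : Hist N A X) (hH : H ≠ []) (l : Fin (N + 1)) :
    P.psi x l 1 H = 0 := by
  funext p
  simp only [psi, Pi.zero_apply, ite_eq_right_iff]
  rintro ⟨-, hs⟩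
  obtain ⟨e, he⟩ := List.exists_mem_of_ne_nil H hH
  by_contra hne
  have hpre : P.pre x 1 = extSC (P.U 1) := mul_one _
  rw [hpre] at hne
  obtain ⟨q, -, hq⟩ := Finset.exists_ne_zero_of_sum_ne_zero hne
  have hqk : q = (P.s0, 0, P.r0, fun _ => 0) := by
    by_contra hcon
    exact right_ne_zero_of_mul hq (if_neg hcon)
  have hpq : p.2.2 = q.2.2 := by
    by_contra hcon
    exact left_ne_zero_of_mul hq (if_neg hcon)
  have h1 := (hs.1 e he).2
  rw [hpq, hqk] at h1
  have := congrArg Fin.val h1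
  rw [Fin.val_zero, Fin.val_one', Nat.mod_eq_of_lt (by omega)] at this
  omega

end Protocol

end

end CIQ

/-- Boundary vanishing: under the flag constraint,
(i) `ψ̄_(0,T,H_k) = 0` for any history with fewer than `N` labs;
(ii) `φ̄_(l,T,H_k) = φ_(l,T,H_k) = 0` for any such history and `l ∈ ℒ_k`;
(iii) `ψ_(l,1,H_k) = 0` for any nonempty history and any `l ∈ {0,1,…,N}`;
(iv) if `N ≥ 2`, then `φ̄_(0,1,H_N) = 0` for any complete history. -/
theorem boundary_vanishing
    (N T : ℕ) (S : Type) [Fintype S] [DecidableEq S]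
    (A : Fin N → Type) [∀ i, Fintype (A i)] [∀ i, DecidableEq (A i)]
    (X : Fin N → Type) [∀ i, Fintype (X i)] [∀ i, DecidableEq (X i)]
    (hN : 1 ≤ N) (hT : N ≤ T)
    (P : Protocol N T S A X) (hVm : P.unitaryVm) (hU : P.unitaryU)
    (x : ∀ l, X l) (hflag : P.flagOK x) :
    (∀ H : Hist N A X, labsDistinct H → H.length < N → P.psibar x 0 T H = 0) ∧
    (∀ (H : Hist N A X) (l : Fin N) (a : A l) (xl : X l), labsDistinct H →
      H.length < N → (⟨l, (a, xl)⟩ : (i : Fin N) × (A i × X i)) ∈ H →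
      P.phibar x l a T H = 0 ∧ P.phiFull x l a T H = 0) ∧
    (∀ H : Hist N A X, H ≠ [] → ∀ l : Fin (N + 1), P.psi x l 1 H = 0) ∧
    (2 ≤ N → ∀ (H : Hist N A X) (a : ∀ i, A i), labsDistinct H →
      (∀ l : Fin N, (⟨l, (a l, x l)⟩ : (i : Fin N) × (A i × X i)) ∈ H) →
      P.phibar0 x 1 H = 0) := by
  have hT1 : 1 ≤ T := hN.trans hT
  refine ⟨fun H _ hH => ?_, fun H l a xl _ hH hmem => ?_,
    fun H hH l => psi_one_eq_zero P x hT1 H hH l, fun _ H a _ hmem => ?_⟩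
  · rw [psibar, hflag.psi_zero_eq_zero hT1 H hH, Matrix.mulVec_zero]
  · obtain ⟨i, hi⟩ := exists_lab_not_mem H hH
    have hphi : P.phiFull x l a T H = 0 :=
      hflag.phiOf_eq_zero hT1 _ l a (fun e he => of_decide_eq_true (List.mem_filter.1 he).2)
        (hi _ hmem).symm (fun e he => hi e (List.mem_filter.1 he).1)
    exact ⟨by rw [phibar, hphi, Matrix.mulVec_zero], hphi⟩
  · rw [phibar0, phi0, psi_one_eq_zero P x hT1 H (List.ne_nil_of_mem (hmem ⟨0, hN⟩)) 0,
      Matrix.mulVec_zero, Matrix.mulVec_zero]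
end

section
/- Quantum switch output probability: for the quantum switch circuit with inputs x = 0 (Alice), y = 1 (Bob), z = 1 (Charlie), the probability of all three parties obtaining outcome 0 is p^quantum(a=0, b=0, c=0 | x=0, y=1, z=1) = 5/16, where p^quantum(abc|xyz) = ‖(|a,b,c⟩⟨a,b,c|_r ⊗ I) 𝒰|0⟩‖² and 𝒰 = V U_3 V U_2 V U_1. -/
open CIQ CIQ.Protocol

noncomputable section

namespace CIQSwitch

/-- The measurement unitaries on `s₁ ⊗ r_l`: for setting `0` the computational-basis
measurement `|0⟩⟨0| ⊗ I + |1⟩⟨1| ⊗ X`, for setting `1` the Fourier-basis measurement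
`|+⟩⟨+| ⊗ I + |−⟩⟨−| ⊗ X`, written out as matrices. -/
def meas : Fin 2 → Matrix (Fin 2 × Fin 2) (Fin 2 × Fin 2) ℂ
  | 0 => fun p q => if p.1 = q.1 ∧ p.2 = q.2 + q.1 then 1 else 0
  | 1 => fun p q =>
      (1 / 2) * ((if p.2 = q.2 then 1 else 0)
        + (-1 : ℂ) ^ ((p.1 : ℕ) + (q.1 : ℕ)) * (if p.2 = q.2 + 1 then 1 else 0))

/-- `V_{s,r_l}(x_l)` for the switch: act with `meas x_l` on `s₁ ⊗ r_l` and trivially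
on `s₂` (the system being the two qubits `s₁ ⊗ s₂`). -/
def VmSw (_ : Fin 3) (xv : Fin 2) :
    Matrix ((Fin 2 × Fin 2) × Fin 2) ((Fin 2 × Fin 2) × Fin 2) ℂ := fun p q =>
  if p.1.2 = q.1.2 then meas xv (p.1.1, p.2) (q.1.1, q.2) else 0

/-- Extension of a control-only operator to `H_s ⊗ H_c`. -/
def extC (M : Matrix (Fin 4) (Fin 4) ℂ) :
    Matrix ((Fin 2 × Fin 2) × Fin 4) ((Fin 2 × Fin 2) × Fin 4) ℂ := fun p q =>
  if p.1 = q.1 then M p.2 q.2 else 0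

/-- `U₂`: exchange `|1⟩_c ↔ |2⟩_c`, fixing `|0⟩_c` and `|3⟩_c`. -/
def U2c : Matrix (Fin 4) (Fin 4) ℂ := fun i j =>
  if i = Equiv.swap (1 : Fin 4) 2 j then 1 else 0

/-- The switch protocol: `N = 3` parties (Alice `0`, Bob `1`, Charlie `2` in
`Fin 3`, i.e. paper labs `1,2,3`), `T = 3` time steps, two-qubit system initialized
`|00⟩`, given `U₁` (any unitary extension sending `|0⟩_c` to `(|1⟩_c+|2⟩_c)/√2`),
the concrete `U₂`, and `U₃` (any unitary extension of the specified action). -/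
def switchP (U1c : Matrix (Fin 4) (Fin 4) ℂ)
    (U3 : Matrix ((Fin 2 × Fin 2) × Fin 4) ((Fin 2 × Fin 2) × Fin 4) ℂ) :
    Protocol 3 3 (Fin 2 × Fin 2) (fun _ => Fin 2) (fun _ => Fin 2) where
  s0 := (0, 0)
  r0 := fun _ => 0
  Vm := VmSw
  U := fun t => if t = 1 then extC U1c else if t = 2 then extC U2c
    else if t = 3 then U3 else 1

/-- The settings `x = 0` (Alice), `y = 1` (Bob), `z = 1` (Charlie). -/
def xsw : Fin 3 → Fin 2 := fun l => if l = 0 then 0 else 1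

/-- The hypotheses on the unitaries `U₁` and `U₃`:
`U₁` is a unitary on the control with `U₁|0⟩_c = (|1⟩_c + |2⟩_c)/√2`, and `U₃` is a
unitary on control and system with `U₃|1⟩_c|ψ⟩_{s₁}|0⟩_{s₂} = |3⟩_c|0⟩_{s₁}|ψ⟩_{s₂}`
and `U₃|2⟩_c|ψ⟩_{s₁}|0⟩_{s₂} = |3⟩_c|1⟩_{s₁}|ψ⟩_{s₂}`. -/
def switchHyp (U1c : Matrix (Fin 4) (Fin 4) ℂ)
    (U3 : Matrix ((Fin 2 × Fin 2) × Fin 4) ((Fin 2 × Fin 2) × Fin 4) ℂ) : Prop :=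
  U1c ∈ Matrix.unitaryGroup (Fin 4) ℂ ∧
  (∀ i : Fin 4, U1c i 0 = if i = 1 ∨ i = 2 then ((Real.sqrt 2 : ℂ))⁻¹ else 0) ∧
  U3 ∈ Matrix.unitaryGroup ((Fin 2 × Fin 2) × Fin 4) ℂ ∧
  (∀ (s1 : Fin 2) (p : (Fin 2 × Fin 2) × Fin 4),
    U3 p ((s1, 0), 1) = if p = (((0 : Fin 2), s1), 3) then 1 else 0) ∧
  (∀ (s1 : Fin 2) (p : (Fin 2 × Fin 2) × Fin 4),
    U3 p ((s1, 0), 2) = if p = (((1 : Fin 2), s1), 3) then 1 else 0)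

/-- The basis ket `|s⟩|c⟩|r⟩|f⟩` of the total Hilbert space of the switch. -/
def ket (s : Fin 2 × Fin 2) (c : Fin 4) (r : Fin 3 → Fin 2) (f : Fin 3 → Fin 4) :
    Idx 3 3 (Fin 2 × Fin 2) (fun _ => Fin 2) → ℂ :=
  Pi.single (s, c, r, f) 1

/-- The projector `|a⟩⟨a|_r ⊗ I` onto the outcomes `a`. -/
def outcomeProj (a : Fin 3 → Fin 2) :
    (Idx 3 3 (Fin 2 × Fin 2) (fun _ => Fin 2) → ℂ) →ₗ[ℂ]
      (Idx 3 3 (Fin 2 × Fin 2) (fun _ => Fin 2) → ℂ) where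
  toFun v := fun p => if p.2.2.1 = a then v p else 0
  map_add' v w := by ext p; by_cases hp : p.2.2.1 = a <;> simp [hp]
  map_smul' k v := by ext p; by_cases hp : p.2.2.1 = a <;> simp [hp]

lemma outcomeProj_ket (a : Fin 3 → Fin 2) (s : Fin 2 × Fin 2) (c : Fin 4)
    (r : Fin 3 → Fin 2) (f : Fin 3 → Fin 4) :
    outcomeProj a (ket s c r f) = if r = a then ket s c r f else 0 := by
  ext p
  by_cases hp : p = (s, c, r, f)
  · subst hp
    by_cases hr : r = a <;> simp [outcomeProj, ket, hr]
  · have h0 : ket s c r f p = 0 := Pi.single_eq_of_ne hp _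
    by_cases hr : r = a
    · subst hr
      simp [outcomeProj, h0]
    · simp [outcomeProj, hr, h0]

lemma extSC_mulVec_ket (M : Matrix ((Fin 2 × Fin 2) × Fin 4) ((Fin 2 × Fin 2) × Fin 4) ℂ)
    (s : Fin 2 × Fin 2) (c : Fin 4) (r : Fin 3 → Fin 2) (f : Fin 3 → Fin 4) :
    (extSC M).mulVec (ket s c r f) = ∑ q, M q (s, c) • ket q.1 q.2 r f := by
  ext ⟨s', c', r', f'⟩
  rw [Finset.sum_apply, Finset.sum_eq_single (s', c')]
  · by_cases h : (r', f') = (r, f)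
    · obtain ⟨rfl, rfl⟩ := Prod.ext_iff.mp h
      simp [ket, extSC]
    · have h' : ((s', c', r', f') : Idx 3 3 (Fin 2 × Fin 2) (fun _ => Fin 2))
          ≠ (s', c', r, f) := fun e => h (congrArg (fun p => p.2.2) e)
      have h'' : ¬ (r' = r ∧ f' = f) := by simpa using h
      simp [ket, extSC, h'']
  · rintro ⟨s'', c''⟩ - hne
    have h' : ((s', c', r', f') : Idx 3 3 (Fin 2 × Fin 2) (fun _ => Fin 2))
        ≠ (s'', c'', r, f) := fun e => hne <| by
      simp only [Prod.mk.injEq] at e ⊢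
      exact ⟨e.1.symm, e.2.1.symm⟩
    simp [ket, Pi.single_eq_of_ne h']
  · simp

lemma Vmat_mulVec_ket (P : Protocol 3 3 (Fin 2 × Fin 2) (fun _ => Fin 2) (fun _ => Fin 2))
    (x : Fin 3 → Fin 2) (s : Fin 2 × Fin 2) (l : Fin 3) (r : Fin 3 → Fin 2)
    (f : Fin 3 → Fin 4) :
    (P.Vmat x).mulVec (ket s l.succ r f) =
      ∑ q : (Fin 2 × Fin 2) × Fin 2, P.Vm l (x l) q (s, r l) •
        ket q.1 l.succ (Function.update r l q.2) (Function.update f l (f l + 1)) := by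
  ext ⟨s', c', r', f'⟩
  rw [Finset.sum_apply, Finset.sum_eq_single (s', r' l)]
  · rw [ket, Matrix.mulVec_single_one, Matrix.col_apply, Protocol.Vmat]
    by_cases hc : c' = l.succ
    · subst hc
      have hupd : (∀ i, i ≠ l → r i = r' i) ∧ (∀ i, i ≠ l → f i = f' i) ∧
          f l + 1 = f' l ↔ r' = Function.update r l (r' l) ∧
            f' = Function.update f l (f l + 1) := by
        simp only [Function.eq_update_iff, true_and]
        grind
      simp [ket, Pi.single_apply, hupd]
      rfl
    · by_cases h0 : c' = 0
      · subst h0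
        simp [ket, hc, (Fin.succ_ne_zero l)]
      · simp [ket, hc, h0, Ne.symm hc]
  · rintro ⟨s'', a⟩ - hne
    have h' : ((s', c', r', f') : Idx 3 3 (Fin 2 × Fin 2) (fun _ => Fin 2))
        ≠ (s'', l.succ, Function.update r l a, Function.update f l (f l + 1)) :=
      fun e => hne <| by
        simp only [Prod.mk.injEq] at e ⊢
        refine ⟨e.1.symm, ?_⟩
        rw [e.2.2.1, Function.update_self]
    simp [ket, Pi.single_eq_of_ne h']
  · simp

lemma switchP_Vmat_mulVec_alice (U1c U3) (s : Fin 2 × Fin 2) (a b c : Fin 2)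
    (i j k : Fin 4) :
    ((switchP U1c U3).Vmat xsw).mulVec (ket s 1 ![a, b, c] ![i, j, k]) =
      ket s 1 ![a + s.1, b, c] ![i + 1, j, k] := by
  have h := Vmat_mulVec_ket (switchP U1c U3) xsw s 0 ![a, b, c] ![i, j, k]
  have hr : ∀ t : Fin 2, Function.update ![a, b, c] 0 t = ![t, b, c] := by
    intro t; ext u; fin_cases u <;> rfl
  have hf : Function.update ![i, j, k] 0 (i + 1) = ![i + 1, j, k] := by
    ext u; fin_cases u <;> rfl
  obtain ⟨s₁, s₂⟩ := s
  refine h.trans ?_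
  simp only [Matrix.cons_val_zero, hr, hf, Fin.succ_zero_eq_one]
  fin_cases s₁ <;> fin_cases s₂ <;> fin_cases a <;>
    simp [switchP, VmSw, meas, xsw, Fintype.sum_prod_type]

/-- The action of a Fourier-basis measurement, given by its effect on the system qubit `s₁`. -/
lemma sum_VmSw_one (l : Fin 3) (s : Fin 2 × Fin 2) (a : Fin 2) (c : Fin 4)
    (r : Fin 2 → Fin 3 → Fin 2) (f : Fin 3 → Fin 4) :
    ∑ q : (Fin 2 × Fin 2) × Fin 2, VmSw l 1 q (s, a) • ket q.1 c (r q.2) f =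
      (1 / 2 : ℂ) • (ket (0, s.2) c (r a) f + ket (1, s.2) c (r a) f) +
      ((1 / 2 : ℂ) * (-1) ^ (s.1 : ℕ)) •
        (ket (0, s.2) c (r (a + 1)) f - ket (1, s.2) c (r (a + 1)) f) := by
  obtain ⟨s₁, s₂⟩ := s
  fin_cases s₁ <;> fin_cases s₂ <;> fin_cases a <;>
    (simp [VmSw, meas, Fintype.sum_prod_type]; module)

lemma switchP_Vmat_mulVec_bob (U1c U3) (s : Fin 2 × Fin 2) (a b c : Fin 2)
    (i j k : Fin 4) :
    ((switchP U1c U3).Vmat xsw).mulVec (ket s 2 ![a, b, c] ![i, j, k]) =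
      (1 / 2 : ℂ) • (ket (0, s.2) 2 ![a, b, c] ![i, j + 1, k] +
        ket (1, s.2) 2 ![a, b, c] ![i, j + 1, k]) +
      ((1 / 2 : ℂ) * (-1) ^ (s.1 : ℕ)) • (ket (0, s.2) 2 ![a, b + 1, c] ![i, j + 1, k] -
        ket (1, s.2) 2 ![a, b + 1, c] ![i, j + 1, k]) := by
  have h := Vmat_mulVec_ket (switchP U1c U3) xsw s 1 ![a, b, c] ![i, j, k]
  have hr : ∀ t : Fin 2, Function.update ![a, b, c] 1 t = ![a, t, c] := by
    intro t; ext u; fin_cases u <;> rfl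
  have hf : Function.update ![i, j, k] 1 (j + 1) = ![i, j + 1, k] := by
    ext u; fin_cases u <;> rfl
  refine h.trans ?_
  simp only [Matrix.cons_val_one, Matrix.cons_val_zero, hr, hf]
  exact sum_VmSw_one 1 s b 2 (fun t => ![a, t, c]) _

lemma switchP_Vmat_mulVec_charlie (U1c U3) (s : Fin 2 × Fin 2) (a b c : Fin 2)
    (i j k : Fin 4) :
    ((switchP U1c U3).Vmat xsw).mulVec (ket s 3 ![a, b, c] ![i, j, k]) =
      (1 / 2 : ℂ) • (ket (0, s.2) 3 ![a, b, c] ![i, j, k + 1] +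
        ket (1, s.2) 3 ![a, b, c] ![i, j, k + 1]) +
      ((1 / 2 : ℂ) * (-1) ^ (s.1 : ℕ)) • (ket (0, s.2) 3 ![a, b, c + 1] ![i, j, k + 1] -
        ket (1, s.2) 3 ![a, b, c + 1] ![i, j, k + 1]) := by
  have h := Vmat_mulVec_ket (switchP U1c U3) xsw s 2 ![a, b, c] ![i, j, k]
  have hr : ∀ t : Fin 2, Function.update ![a, b, c] 2 t = ![a, b, t] := by
    intro t; ext u; fin_cases u <;> rfl
  have hf : Function.update ![i, j, k] 2 (k + 1) = ![i, j, k + 1] := by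
    ext u; fin_cases u <;> rfl
  refine h.trans ?_
  simp only [Matrix.cons_val, hr, hf]
  exact sum_VmSw_one 2 s c 3 (fun t => ![a, b, t]) _

lemma nsq_sum_smul_ket (g : Fin 2 × Fin 2 → ℂ) (c : Fin 4) (r : Fin 3 → Fin 2)
    (f : Fin 3 → Fin 4) :
    nsq (∑ s, g s • ket s c r f) = ∑ s, Complex.normSq (g s) := by
  have h : ∀ p : Idx 3 3 (Fin 2 × Fin 2) (fun _ => Fin 2),
      Complex.normSq ((∑ s, g s • ket s c r f) p) =
        if p.2 = (c, r, f) then Complex.normSq (g p.1) else 0 := by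
    rintro ⟨s', k⟩
    by_cases hk : k = (c, r, f)
    · simp [hk, ket, Finset.sum_apply, Pi.single_apply]
    · simp [hk, ket, Finset.sum_apply]
  simp only [nsq, h]
  rw [Fintype.sum_prod_type]
  simp

/-- The quantum switch output probability:
`p^quantum(a=0, b=0, c=0 | x=0, y=1, z=1) = 5/16`. -/
theorem switch_probability
    (U1c : Matrix (Fin 4) (Fin 4) ℂ)
    (U3 : Matrix ((Fin 2 × Fin 2) × Fin 4) ((Fin 2 × Fin 2) × Fin 4) ℂ)
    (h : switchHyp U1c U3) :
    (switchP U1c U3).pQ xsw (fun _ => 0) = 5 / 16 := by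
  obtain ⟨-, hU1, -, hU31, hU32⟩ := h
  have hket : (switchP U1c U3).ket0 = ket (0, 0) 0 ![0, 0, 0] ![0, 0, 0] := by
    ext p
    have hr : (fun _ => 0 : Fin 3 → Fin 2) = ![0, 0, 0] := by decide
    have hf : (fun _ => 0 : Fin 3 → Fin 4) = ![0, 0, 0] := by decide
    simp only [ket0, ket, switchP, Pi.single_apply, hr, hf]
  have hjoin : ∀ (s : Fin 2) r f, (extSC U3).mulVec (ket (s, 0) 1 r f) = ket (0, s) 3 r f := by
    intro s r f
    simp [extSC_mulVec_ket, hU31]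
  have hjoin' : ∀ (s : Fin 2) r f,
      (extSC U3).mulVec (ket (s, 0) 2 r f) = ket (1, s) 3 r f := by
    intro s r f
    simp [extSC_mulVec_ket, hU32]
  have hstart : ∀ r f, (extSC (extC U1c)).mulVec (ket (0, 0) 0 r f) =
      (Real.sqrt 2 : ℂ)⁻¹ • (ket (0, 0) 1 r f + ket (0, 0) 2 r f) := by
    intro r f
    simp [extSC_mulVec_ket, extC, hU1, Fintype.sum_prod_type, Fin.sum_univ_succ]
  have hswap : ∀ s r f, (extSC (extC U2c)).mulVec (ket s 1 r f) = ket s 2 r f := by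
    intro s r f
    simp [extSC_mulVec_ket, extC, U2c, Fintype.sum_prod_type]
  have hswap' : ∀ s r f, (extSC (extC U2c)).mulVec (ket s 2 r f) = ket s 1 r f := by
    intro s r f
    simp [extSC_mulVec_ket, extC, U2c, Fintype.sum_prod_type]
  have hproj : outcomeProj (fun _ => 0)
      (((switchP U1c U3).Uop xsw).mulVec (ket (0, 0) 0 ![0, 0, 0] ![0, 0, 0])) =
      ∑ s : Fin 2 × Fin 2, ((Real.sqrt 2 : ℂ)⁻¹ * (if s.2 = 0 then 1 / 2 else 1 / 4)) •
        ket s 3 ![0, 0, 0] ![1, 1, 1] := by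
    have hU : (switchP U1c U3).U 1 = extC U1c ∧ (switchP U1c U3).U 2 = extC U2c ∧
      (switchP U1c U3).U 3 = U3 := ⟨rfl, rfl, rfl⟩
    have h000 : (fun _ => 0 : Fin 3 → Fin 2) = ![0, 0, 0] := by decide
    simp only [Uop, chain, zero_add, Nat.reduceAdd, hU, mul_one, ← Matrix.mulVec_mulVec,
      hstart, Matrix.mulVec_add, Matrix.mulVec_sub, Matrix.mulVec_smul, hswap, hswap', hjoin,
      hjoin', switchP_Vmat_mulVec_alice, switchP_Vmat_mulVec_bob, switchP_Vmat_mulVec_charlie,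
      map_add, map_sub, map_smul, outcomeProj_ket, h000]
    simp [Fintype.sum_prod_type]
    module
  have hsq : Complex.normSq (Real.sqrt 2 : ℂ)⁻¹ = 1 / 2 := by
    rw [map_inv₀, Complex.normSq_ofReal, Real.mul_self_sqrt (by norm_num), one_div]
  calc (switchP U1c U3).pQ xsw (fun _ => 0)
      = nsq (outcomeProj (fun _ => 0) (((switchP U1c U3).Uop xsw).mulVec
          (switchP U1c U3).ket0)) := rfl
    _ = 5 / 16 := by
      rw [hket, hproj, nsq_sum_smul_ket]
      simp only [map_mul, hsq, Fintype.sum_prod_type, Fin.sum_univ_two]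
      norm_num [Complex.normSq_apply]

end CIQSwitch

end
end

section
/- Explicit causal model for the switch: applying Definitions 4–5 to the quantum switch circuit with settings x = 0, y = 1, z = 1 yields p_1(l_1 = Alice | H_0) = p_1(l_1 = Bob | H_0) = 1/2; p_2(l_2 = Bob | H_1 = ((1,0,0))) = 1 and p_2(l_2 = Alice | H_1 = ((2,0,1))) = 1; p_1(a=0 | H_0, x=0) = 1 and p_1(b=0 | H_0, y=1) = 1/2; p_2(a=0 | H_1 = ((2,0,1)), x=0) = 1/2 and p_2(b=0 | H_1 = ((1,0,0)), y=1) = 1/2; and p_3(c=0 | H_2, z=1) = 5/6 for both orderings H_2 = ((1,0,0),(2,0,1)) and H_2 = ((2,0,1),(1,0,0)). Consequently the resulting causal model assigns p(000|011) = (1/2)(1)(1/2)(5/6) + (1/2)(1/2)(1/2)(5/6)... summed over both orders, = 5/16, matching the quantum switch probability. -/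
open CIQ CIQ.Protocol

noncomputable section

namespace CIQSwitch

/-- Histories for the switch: `(lab, outcome, setting)` triples, with Alice `= 0`,
Bob `= 1`, Charlie `= 2` (paper labs `1,2,3`). -/
abbrev SwHist := Hist 3 (fun _ => Fin 2) (fun _ => Fin 2)

/-- `H₁ = ((1,0,0))`: Alice acted first, outcome `0`, setting `0`. -/
def HA : SwHist := [⟨0, (0, 0)⟩]

/-- `H₁ = ((2,0,1))`: Bob acted first, outcome `0`, setting `1`. -/
def HB : SwHist := [⟨1, (0, 1)⟩]

/-- `H₂ = ((1,0,0),(2,0,1))`. -/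
def HAB : SwHist := [⟨0, (0, 0)⟩, ⟨1, (0, 1)⟩]

/-- `H₂ = ((2,0,1),(1,0,0))`. -/
def HBA : SwHist := [⟨1, (0, 1)⟩, ⟨0, (0, 0)⟩]

/-- Basis index set of the switch circuit. -/
abbrev SwIdx := Idx 3 3 (Fin 2 × Fin 2) (fun _ => Fin 2)

/-- A sparse integer combination of basis kets. -/
abbrev Ketsum := List (ℤ × SwIdx)

/-- The amplitude of a sparse combination at a basis index. -/
def amp (L : Ketsum) (p : SwIdx) : ℤ := (L.map fun e => if e.2 = p then e.1 else 0).sum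

/-- The vector represented by a sparse combination with a global scalar. -/
def vec (k : ℂ) (L : Ketsum) : SwIdx → ℂ := fun p => k * (amp L p : ℂ)

/-- The squared norm of a sparse combination. -/
def gram (L : Ketsum) : ℤ := (L.map fun e => e.1 * amp L e.2).sum

/-- Linear extension of a map sending basis kets to sparse combinations. -/
def act (step : SwIdx → Ketsum) (L : Ketsum) : Ketsum :=
  L.flatMap fun e => (step e.2).map fun d => (e.1 * d.1, d.2)

lemma amp_nil (p : SwIdx) : amp [] p = 0 := rfl

lemma amp_cons (e : ℤ × SwIdx) (L : Ketsum) (p : SwIdx) :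
    amp (e :: L) p = (if e.2 = p then e.1 else 0) + amp L p := by
  simp [amp]

lemma amp_append (L M : Ketsum) (p : SwIdx) : amp (L ++ M) p = amp L p + amp M p := by
  simp [amp]

lemma amp_map_mul (c : ℤ) (L : Ketsum) (p : SwIdx) :
    amp (L.map fun d => (c * d.1, d.2)) p = c * amp L p := by
  induction L with
  | nil => simp [amp]
  | cons e L ih => rw [List.map_cons, amp_cons, ih, amp_cons]; split_ifs <;> ring

lemma amp_filter (Q : SwIdx → Prop) [DecidablePred Q] (L : Ketsum) (p : SwIdx) :
    amp (L.filter fun e => decide (Q e.2)) p = if Q p then amp L p else 0 := by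
  induction L with
  | nil => simp [amp]
  | cons e L ih =>
    by_cases hp : e.2 = p
    · subst hp
      by_cases hQ : Q e.2 <;> simp_all [amp_cons]
    · by_cases hQ : Q e.2 <;> simp_all [amp_cons]

lemma sum_amp_mul_amp (L M : Ketsum) :
    ∑ p, amp L p * amp M p = (L.map fun e => e.1 * amp M e.2).sum := by
  induction L with
  | nil => simp [amp_nil]
  | cons e L ih => simp [amp_cons, add_mul, Finset.sum_add_distrib, ih]

lemma nsq_vec (k : ℂ) (L : Ketsum) : nsq (vec k L) = Complex.normSq k * (gram L : ℝ) := by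
  rw [gram, ← sum_amp_mul_amp, nsq, Int.cast_sum, Finset.mul_sum]
  refine Finset.sum_congr rfl fun p _ => ?_
  rw [vec, Complex.normSq_mul, Complex.normSq_intCast, Int.cast_mul]

lemma ite_vec (Q : SwIdx → Prop) [DecidablePred Q] (k : ℂ) (L : Ketsum) :
    (fun p => if Q p then vec k L p else 0) = vec k (L.filter fun e => decide (Q e.2)) := by
  funext p
  simp only [vec, amp_filter]
  split_ifs <;> simp

lemma mulVec_vec (M : Matrix SwIdx SwIdx ℂ) (κ k : ℂ) (step : SwIdx → Ketsum) (L : Ketsum)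
    (hM : ∀ e ∈ L, ∀ p, M p e.2 = κ * (amp (step e.2) p : ℂ)) :
    M.mulVec (vec k L) = vec (κ * k) (act step L) := by
  funext p
  rw [Matrix.mulVec, dotProduct]
  induction L with
  | nil => simp [vec, act, amp_nil]
  | cons e L ih =>
    have he := hM e (by simp) p
    have ih' := ih fun e' h' => hM e' (by simp [h'])
    simp only [vec, act, List.flatMap_cons, amp_append, amp_map_mul, amp_cons] at ih' ⊢
    simp only [Int.cast_add, Int.cast_mul, mul_add, Finset.sum_add_distrib, ih']
    simp [he]
    ring

/-- Twice the action of the lab activation on a basis ket. -/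
def stepV (q : SwIdx) : Ketsum :=
  if h : q.2.1 = 0 then [(2, q)]
  else
    let l := q.2.1.pred h
    let out (b e : Fin 2) : SwIdx :=
      ((b, q.1.2), q.2.1, Function.update q.2.2.1 l (q.2.2.1 l + e),
        Function.update q.2.2.2 l (q.2.2.2 l + 1))
    if xsw l = 0 then [(2, out q.1.1 q.1.1)]
    else [(1, out 0 0), (1, out 1 0), ((-1) ^ (q.1.1 : ℕ), out 0 1),
      ((-1) ^ ((q.1.1 : ℕ) + 1), out 1 1)]

/-- The action of `U₁` on the initial ket, up to normalization. -/
def stepU1 (q : SwIdx) : Ketsum := [(1, (q.1, 1, q.2.2)), (1, (q.1, 2, q.2.2))]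

/-- The action of `U₂` on a basis ket. -/
def stepU2 (q : SwIdx) : Ketsum := [(1, (q.1, Equiv.swap 1 2 q.2.1, q.2.2))]

/-- The action of `U₃` on a basis ket with control `1` or `2` and second qubit `0`. -/
def stepU3 (q : SwIdx) : Ketsum :=
  [(1, ((if q.2.1 = 1 then 0 else 1, q.1.1), 3, q.2.2))]

lemma stepV_succ (s : Fin 2 × Fin 2) (l : Fin 3) (r : Fin 3 → Fin 2) (f : Fin 3 → Fin 4) :
    stepV (s, l.succ, r, f) =
      let out (b e : Fin 2) : SwIdx :=
        ((b, s.2), l.succ, Function.update r l (r l + e), Function.update f l (f l + 1))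
      if xsw l = 0 then [(2, out s.1 s.1)]
      else [(1, out 0 0), (1, out 1 0), ((-1) ^ (s.1 : ℕ), out 0 1),
        ((-1) ^ ((s.1 : ℕ) + 1), out 1 1)] :=
  dif_neg (Fin.succ_ne_zero l)

lemma Vmat_eq (U1c : Matrix (Fin 4) (Fin 4) ℂ)
    (U3 : Matrix ((Fin 2 × Fin 2) × Fin 4) ((Fin 2 × Fin 2) × Fin 4) ℂ) (p q : SwIdx) :
    (switchP U1c U3).Vmat xsw p q = 1 / 2 * (amp (stepV q) p : ℂ) := by
  obtain ⟨⟨s1, s2⟩, c, r, f⟩ := q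
  obtain ⟨⟨b1, b2⟩, c', r', f'⟩ := p
  by_cases hc : c' = c
  swap
  · have h1 : amp (stepV ((s1, s2), c, r, f)) ((b1, b2), c', r', f') = 0 := by
      unfold stepV
      dsimp only
      split_ifs <;> simp [amp_cons, amp_nil, Ne.symm hc]
    rw [h1]
    simp [Vmat, Ne.symm hc]
  subst hc
  by_cases h0 : c' = 0
  · subst h0
    simp [Vmat, stepV, amp_cons, amp_nil]
  obtain ⟨l, rfl⟩ := Fin.exists_succ_eq.mpr h0
  have key : ∀ b e : Fin 2,
      ((((b, s2), l.succ, Function.update r l (r l + e), Function.update f l (f l + 1)) : SwIdx)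
        = ((b1, b2), l.succ, r', f')) ↔
      (((∀ i, i ≠ l → r i = r' i) ∧ (∀ i, i ≠ l → f i = f' i) ∧ f l + 1 = f' l) ∧
        b2 = s2 ∧ b = b1 ∧ r' l = r l + e) := by
    intro b e
    simp only [Prod.mk.injEq, true_and, Function.update_eq_iff]
    constructor
    · rintro ⟨⟨h1, h2⟩, ⟨h3, h4⟩, h5, h6⟩
      exact ⟨⟨h4, h6, h5⟩, h2.symm, h1, h3.symm⟩
    · rintro ⟨⟨h4, h6, h5⟩, h2, h1, h3⟩
      exact ⟨⟨h1, h2.symm⟩, ⟨h3.symm, h4⟩, h5, h6⟩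
  rw [stepV_succ]
  by_cases hG : (∀ i, i ≠ l → r i = r' i) ∧ (∀ i, i ≠ l → f i = f' i) ∧ f l + 1 = f' l
  swap
  · have hL : (switchP U1c U3).Vmat xsw ((b1, b2), l.succ, r', f') ((s1, s2), l.succ, r, f) = 0 :=
      (dif_neg (Fin.succ_ne_zero l)).trans (if_neg fun h => hG h.2)
    rw [hL]
    dsimp only
    split_ifs <;> simp only [amp_cons, amp_nil, key, hG, false_and, if_false] <;> simp
  have hL : (switchP U1c U3).Vmat xsw ((b1, b2), l.succ, r', f') ((s1, s2), l.succ, r, f)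
      = VmSw l (xsw l) ((b1, b2), r' l) ((s1, s2), r l) :=
    (dif_neg (Fin.succ_ne_zero l)).trans (if_pos ⟨rfl, hG⟩)
  rw [hL]
  by_cases h2 : b2 = s2
  swap
  · dsimp only
    split_ifs <;> simp only [amp_cons, amp_nil, key, h2, false_and, and_false, if_false, VmSw] <;>
      simp
  subst h2
  replace key := fun b e => (key b e).trans (and_iff_right hG)
  by_cases hx : xsw l = 0
  · simp only [hx, if_true, amp_cons, amp_nil, key, true_and, VmSw, meas]
    generalize r' l = u
    generalize r l = v
    clear hL hG key
    fin_cases b1 <;> fin_cases s1 <;> fin_cases u <;> fin_cases v <;> norm_num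
  · have hx1 : xsw l = 1 := by omega
    simp only [hx1, one_ne_zero, if_false, if_true, amp_cons, amp_nil, key, true_and, VmSw, meas]
    generalize r' l = u
    generalize r l = v
    clear hL hG key
    fin_cases b1 <;> fin_cases s1 <;> fin_cases u <;> fin_cases v <;> norm_num

section Evolution

variable (U1c : Matrix (Fin 4) (Fin 4) ℂ)
  (U3 : Matrix ((Fin 2 × Fin 2) × Fin 4) ((Fin 2 × Fin 2) × Fin 4) ℂ)

lemma Vmat_mulVec_vec (k : ℂ) (L : Ketsum) :
    ((switchP U1c U3).Vmat xsw).mulVec (vec k L) = vec (1 / 2 * k) (act stepV L) :=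
  mulVec_vec _ _ _ _ _ fun e _ p => Vmat_eq U1c U3 p e.2

/-- The sparse form of the state just before the first activation. -/
def state1 : Ketsum := act stepU1 [(1, ((0, 0), 0, fun _ => 0, fun _ => 0))]

/-- The sparse form of the state just before the second activation. -/
def state2 : Ketsum := act stepU2 (act stepV state1)

/-- The sparse form of the state just before the third activation. -/
def state3 : Ketsum := act stepU3 (act stepV state2)

variable {U1c U3}

lemma pre_one (h : switchHyp U1c U3) :
    ((switchP U1c U3).pre xsw 1).mulVec (switchP U1c U3).ket0
      = vec ((Real.sqrt 2 : ℂ))⁻¹ state1 := by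
  have h0 : (switchP U1c U3).ket0 (T := 3)
      = vec 1 [(1, ((0, 0), 0, fun _ => 0, fun _ => 0))] := by
    funext p
    simp [ket0, vec, amp_cons, amp_nil, switchP, eq_comm (b := p)]
  rw [pre, chain, mul_one, h0, mulVec_vec _ ((Real.sqrt 2 : ℂ))⁻¹ _ stepU1, mul_one, state1]
  rintro e he ⟨s, c, rf⟩
  obtain rfl := List.mem_singleton.mp he
  simp only [extSC, switchP, extC, stepU1, amp_cons, amp_nil, if_true, h.2.1, Prod.mk.injEq]
  by_cases h1 : s = (0, 0) <;> by_cases h2 : rf = (fun _ => 0, fun _ => 0) <;>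
    simp [h1, h2, eq_comm]
  fin_cases c <;> simp

lemma pre_two (h : switchHyp U1c U3) :
    ((switchP U1c U3).pre xsw 2).mulVec (switchP U1c U3).ket0
      = vec (1 / 2 * ((Real.sqrt 2 : ℂ))⁻¹) state2 := by
  have h1 : (switchP U1c U3).pre xsw 2
      = extSC (extC U2c) * ((switchP U1c U3).Vmat xsw * (switchP U1c U3).pre xsw 1) := rfl
  rw [h1, ← Matrix.mulVec_mulVec, ← Matrix.mulVec_mulVec, pre_one h, Vmat_mulVec_vec,
    mulVec_vec _ 1 _ stepU2, one_mul, state2]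
  rintro ⟨a, s', c', rf'⟩ - ⟨s, c, rf⟩
  simp only [extSC, extC, U2c, stepU2, amp_cons, amp_nil, Prod.mk.injEq]
  by_cases h1 : s = s' <;> by_cases h2 : rf = rf' <;>
    simp [h1, h2, eq_comm (b := s), eq_comm (b := rf), eq_comm (b := c)]

lemma pre_three (h : switchHyp U1c U3) :
    ((switchP U1c U3).pre xsw 3).mulVec (switchP U1c U3).ket0
      = vec (1 / 4 * ((Real.sqrt 2 : ℂ))⁻¹) state3 := by
  have h1 : (switchP U1c U3).pre xsw 3
      = extSC U3 * ((switchP U1c U3).Vmat xsw * (switchP U1c U3).pre xsw 2) := rfl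
  rw [h1, ← Matrix.mulVec_mulVec, ← Matrix.mulVec_mulVec, pre_two h, Vmat_mulVec_vec,
    mulVec_vec _ 1 _ stepU3, state3]
  · congr 1
    ring
  have hs : ∀ e ∈ act stepV state2, e.2.1.2 = 0 ∧ (e.2.2.1 = 1 ∨ e.2.2.1 = 2) := by
    decide +kernel
  rintro ⟨a, ⟨s1, s2⟩, c', rf'⟩ he ⟨s, c, rf⟩
  obtain ⟨hs2, hc⟩ := hs _ he
  dsimp only at hs2 hc
  subst hs2
  by_cases h2 : rf = rf'
  swap
  · simp [extSC, stepU3, amp_cons, amp_nil, h2, Ne.symm h2]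
  subst h2
  rcases hc with rfl | rfl
  · simp [extSC, stepU3, amp_cons, amp_nil, h.2.2.2.1, eq_comm]
  · simp [extSC, stepU3, amp_cons, amp_nil, h.2.2.2.2, eq_comm]

/-- The sparse form of `psi`, from that of the state before the activation. -/
def projPsi (H : SwHist) (l : Fin 3) (L : Ketsum) : Ketsum :=
  L.filter fun e => decide (e.2.2.1 = l.succ ∧ histSat H e.2.2.2.1 e.2.2.2.2)

/-- The sparse form of `phiOf`, from that of the state before the activation. -/
def projPhi (H : SwHist) (l : Fin 3) (a : Fin 2) (L : Ketsum) : Ketsum :=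
  (act stepV (projPsi H l L)).filter fun e => decide (e.2.2.2.1 l = a)

lemma psi_eq_vec {t : ℕ} {k : ℂ} {L : Ketsum} (H : SwHist) (l : Fin 3)
    (ht : ((switchP U1c U3).pre xsw t).mulVec (switchP U1c U3).ket0 = vec k L) :
    (switchP U1c U3).psi xsw l.succ t H = vec k (projPsi H l L) := by
  rw [projPsi, ← ite_vec (fun p : SwIdx => p.2.1 = l.succ ∧ histSat H p.2.2.1 p.2.2.2), ← ht]
  rfl

lemma phiOf_eq_vec {t : ℕ} {k : ℂ} {L : Ketsum} (H : SwHist) (l : Fin 3) (a : Fin 2)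
    (ht : ((switchP U1c U3).pre xsw t).mulVec (switchP U1c U3).ket0 = vec k L) :
    (switchP U1c U3).phiOf xsw l a t H = vec (1 / 2 * k) (projPhi H l a L) := by
  rw [projPhi, ← ite_vec (fun p : SwIdx => p.2.2.1 l = a), ← Vmat_mulVec_vec U1c U3,
    ← psi_eq_vec H l ht]
  rfl

/-- `32 Σ_t ‖ψ_{(l,t,H)}‖²`. -/
def weightPsi (H : SwHist) (l : Fin 3) : ℤ :=
  16 * gram (projPsi H l state1) + 4 * gram (projPsi H l state2) + gram (projPsi H l state3)

/-- `128 Σ_t ‖φ_{(l,t,(H,(l,a,x_l)))}‖²`. -/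
def weightPhi (H : SwHist) (l : Fin 3) (a : Fin 2) : ℤ :=
  16 * gram (projPhi H l a state1) + 4 * gram (projPhi H l a state2)
    + gram (projPhi H l a state3)

lemma normSq_inv_sqrt_two : Complex.normSq ((Real.sqrt 2 : ℂ))⁻¹ = 1 / 2 := by
  rw [Complex.normSq_inv, Complex.normSq_ofReal, Real.mul_self_sqrt zero_le_two, one_div]

lemma sum_Icc_one_three (g : ℕ → ℝ) : ∑ t ∈ Finset.Icc 1 3, g t = g 1 + g 2 + g 3 := by
  simp [Finset.sum_Icc_succ_top]

lemma numPsi_eq (h : switchHyp U1c U3) (H : SwHist) (l : Fin 3) :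
    (switchP U1c U3).numPsi xsw H l = (weightPsi H l : ℝ) / 32 := by
  rw [numPsi, sum_Icc_one_three, psi_eq_vec H l (pre_one h), psi_eq_vec H l (pre_two h),
    psi_eq_vec H l (pre_three h)]
  simp only [nsq_vec, Complex.normSq_mul, normSq_inv_sqrt_two, weightPsi]
  norm_num [Complex.normSq]
  ring

lemma numPhi_eq (h : switchHyp U1c U3) (H : SwHist) (l : Fin 3) (a : Fin 2) :
    (switchP U1c U3).numPhi xsw H l a = (weightPhi H l a : ℝ) / 128 := by
  rw [numPhi, sum_Icc_one_three, phiOf_eq_vec H l a (pre_one h), phiOf_eq_vec H l a (pre_two h),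
    phiOf_eq_vec H l a (pre_three h)]
  simp only [nsq_vec, Complex.normSq_mul, normSq_inv_sqrt_two, weightPhi]
  norm_num [Complex.normSq]
  ring

lemma pNext_eq (h : switchHyp U1c U3) (H : SwHist) (l : Fin 3) {m n : ℤ}
    (hm : weightPsi H l = m)
    (hn : ∑ l' ∈ Finset.univ.filter (fun l' : Fin 3 => ∀ e ∈ H, e.1 ≠ l'), weightPsi H l' = n) :
    (switchP U1c U3).pNext xsw H l = m / n := by
  rw [pNext, denPsi, numPsi_eq h, Finset.sum_congr rfl fun l' _ => numPsi_eq h H l',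
    ← Finset.sum_div, ← Int.cast_sum, hn, hm, div_div_div_cancel_right₀ (by norm_num)]

lemma pOut_eq (h : switchHyp U1c U3) (H : SwHist) (l : Fin 3) (a : Fin 2) {m n : ℤ}
    (hm : weightPhi H l a = m) (hn : ∑ a' : Fin 2, weightPhi H l a' = n) :
    (switchP U1c U3).pOut xsw H l a = m / n := by
  rw [pOut, numPhi_eq h, Finset.sum_congr rfl fun a' _ => numPhi_eq h H l a',
    ← Finset.sum_div, ← Int.cast_sum, hn, hm, div_div_div_cancel_right₀ (by norm_num)]

lemma pQ_eq (h : switchHyp U1c U3) (a : Fin 3 → Fin 2) {m : ℤ}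
    (hm : gram ((act stepV state3).filter fun e => decide (e.2.2.2.1 = a)) = m) :
    (switchP U1c U3).pQ xsw a = m / 128 := by
  have h1 : (switchP U1c U3).Uop xsw
      = (switchP U1c U3).Vmat xsw * (switchP U1c U3).pre xsw 3 := rfl
  rw [pQ, h1, ← Matrix.mulVec_mulVec, pre_three h, Vmat_mulVec_vec,
    ite_vec (fun p : SwIdx => p.2.2.1 = a), nsq_vec, hm]
  simp only [Complex.normSq_mul, normSq_inv_sqrt_two]
  norm_num [Complex.normSq]
  ring

end Evolution

/-- The explicit causal model for the switch obtained from Definitions 4–5: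
the 'who is next?' and 'what did they see?' probabilities take the listed values,
and the resulting causal model reproduces `p(000|011) = 5/16`, matching the quantum
switch probability. -/
theorem switch_explicit_causal_model
    (U1c : Matrix (Fin 4) (Fin 4) ℂ)
    (U3 : Matrix ((Fin 2 × Fin 2) × Fin 4) ((Fin 2 × Fin 2) × Fin 4) ℂ)
    (h : switchHyp U1c U3) :
    (switchP U1c U3).pNext xsw [] 0 = 1 / 2 ∧
    (switchP U1c U3).pNext xsw [] 1 = 1 / 2 ∧
    (switchP U1c U3).pNext xsw HA 1 = 1 ∧
    (switchP U1c U3).pNext xsw HB 0 = 1 ∧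
    (switchP U1c U3).pNext xsw HAB 2 = 1 ∧
    (switchP U1c U3).pNext xsw HBA 2 = 1 ∧
    (switchP U1c U3).pOut xsw [] 0 0 = 1 ∧
    (switchP U1c U3).pOut xsw [] 1 0 = 1 / 2 ∧
    (switchP U1c U3).pOut xsw HB 0 0 = 1 / 2 ∧
    (switchP U1c U3).pOut xsw HA 1 0 = 1 / 2 ∧
    (switchP U1c U3).pOut xsw HAB 2 0 = 5 / 6 ∧
    (switchP U1c U3).pOut xsw HBA 2 0 = 5 / 6 ∧
    causalSum ((switchP U1c U3).pNext xsw)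
      (fun H l _ a => (switchP U1c U3).pOut xsw H l a) xsw (fun _ => 0) 3 [] = 5 / 16 ∧
    (switchP U1c U3).pQ xsw (fun _ => 0) = 5 / 16 := by
  have n0 : (switchP U1c U3).pNext xsw [] 0 = 1 / 2 := by
    rw [pNext_eq h [] 0 (m := 16) (n := 32) (by decide +kernel) (by decide +kernel)]; norm_num
  have n1 : (switchP U1c U3).pNext xsw [] 1 = 1 / 2 := by
    rw [pNext_eq h [] 1 (m := 16) (n := 32) (by decide +kernel) (by decide +kernel)]; norm_num
  have n2 : (switchP U1c U3).pNext xsw [] 2 = 0 := by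
    rw [pNext_eq h [] 2 (m := 0) (n := 32) (by decide +kernel) (by decide +kernel)]; norm_num
  have nA1 : (switchP U1c U3).pNext xsw HA 1 = 1 := by
    rw [pNext_eq h HA 1 (m := 16) (n := 16) (by decide +kernel) (by decide +kernel)]; norm_num
  have nA2 : (switchP U1c U3).pNext xsw HA 2 = 0 := by
    rw [pNext_eq h HA 2 (m := 0) (n := 16) (by decide +kernel) (by decide +kernel)]; norm_num
  have nB0 : (switchP U1c U3).pNext xsw HB 0 = 1 := by
    rw [pNext_eq h HB 0 (m := 8) (n := 8) (by decide +kernel) (by decide +kernel)]; norm_num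
  have nB2 : (switchP U1c U3).pNext xsw HB 2 = 0 := by
    rw [pNext_eq h HB 2 (m := 0) (n := 8) (by decide +kernel) (by decide +kernel)]; norm_num
  have nAB : (switchP U1c U3).pNext xsw HAB 2 = 1 := by
    rw [pNext_eq h HAB 2 (m := 12) (n := 12) (by decide +kernel) (by decide +kernel)]; norm_num
  have nBA : (switchP U1c U3).pNext xsw HBA 2 = 1 := by
    rw [pNext_eq h HBA 2 (m := 12) (n := 12) (by decide +kernel) (by decide +kernel)]; norm_num
  have o0 : (switchP U1c U3).pOut xsw [] 0 0 = 1 := by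
    rw [pOut_eq h [] 0 0 (m := 64) (n := 64) (by decide +kernel) (by decide +kernel)]; norm_num
  have o1 : (switchP U1c U3).pOut xsw [] 1 0 = 1 / 2 := by
    rw [pOut_eq h [] 1 0 (m := 32) (n := 64) (by decide +kernel) (by decide +kernel)]; norm_num
  have oB : (switchP U1c U3).pOut xsw HB 0 0 = 1 / 2 := by
    rw [pOut_eq h HB 0 0 (m := 16) (n := 32) (by decide +kernel) (by decide +kernel)]; norm_num
  have oA : (switchP U1c U3).pOut xsw HA 1 0 = 1 / 2 := by
    rw [pOut_eq h HA 1 0 (m := 32) (n := 64) (by decide +kernel) (by decide +kernel)]; norm_num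
  have oAB : (switchP U1c U3).pOut xsw HAB 2 0 = 5 / 6 := by
    rw [pOut_eq h HAB 2 0 (m := 40) (n := 48) (by decide +kernel) (by decide +kernel)]; norm_num
  have oBA : (switchP U1c U3).pOut xsw HBA 2 0 = 5 / 6 := by
    rw [pOut_eq h HBA 2 0 (m := 40) (n := 48) (by decide +kernel) (by decide +kernel)]; norm_num
  refine ⟨n0, n1, nA1, nB0, nAB, nBA, o0, o1, oB, oA, oAB, oBA, ?_, ?_⟩
  · have eA : ([⟨0, (0, xsw 0)⟩] : SwHist) = HA := rfl
    have eB : ([⟨1, (0, xsw 1)⟩] : SwHist) = HB := rfl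
    have eAB : HA ++ HB = HAB := rfl
    have eBA : HB ++ HA = HBA := rfl
    have mA (l : Fin 3) : (∀ e ∈ HA, e.1 ≠ l) ↔ l ≠ 0 := by simp [HA, eq_comm]
    have mB (l : Fin 3) : (∀ e ∈ HB, e.1 ≠ l) ↔ l ≠ 1 := by simp [HB, eq_comm]
    have mAB (l : Fin 3) : (∀ e ∈ HAB, e.1 ≠ l) ↔ l = 2 := by revert l; decide
    have mBA (l : Fin 3) : (∀ e ∈ HBA, e.1 ≠ l) ↔ l = 2 := by revert l; decide
    simp only [causalSum, Fin.sum_univ_three, List.nil_append, n0, n1, n2, o0, o1, eA, eB, mA,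
      mB, nA1, nA2, nB0, nB2, oA, oB, eAB, eBA, mAB, mBA, nAB, nBA, oAB, oBA, zero_mul]
    norm_num [show (0 : Fin 3) ≠ 2 by decide, show (1 : Fin 3) ≠ 2 by decide]
  · rw [pQ_eq h (fun _ => 0) (m := 40) (by decide +kernel)]; norm_num

end CIQSwitch

end
end

section
/- Convexity of causal distributions: for a fixed number of parties N and fixed finite outcome and setting sets, the set of causal conditional distributions p(a⃗|x⃗) (those admitting a causal-model decomposition as in Definition 1) is convex: if p and q are causal and 0 ≤ λ ≤ 1, then λp + (1−λ)q is causal. -/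
/-!
Causal models (Definition 1 of Purves & Short, "Quantum theory cannot violate a
causal inequality"): `N` parties with finite outcome sets `A i` and finite setting
sets `X i`.  A conditional distribution `p(a⃗|x⃗)` is causal if it is reproduced by
'who is next?' probabilities `q` and 'what did they see?' probabilities `o`,
conditioned on histories (ordered lists of (lab, outcome, setting) triples).
-/

noncomputable section

namespace CIQC

variable {N : ℕ}
variable {A : Fin N → Type} [∀ i, Fintype (A i)] [∀ i, DecidableEq (A i)]
variable {X : Fin N → Type} [∀ i, Fintype (X i)] [∀ i, DecidableEq (X i)]

/-- A history: an ordered list of triples (lab, outcome, setting). -/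
abbrev Hist (N : ℕ) (A X : Fin N → Type) : Type := List ((l : Fin N) × (A l × X l))

/-- The labs occurring in a history are pairwise distinct. -/
def labsDistinct (H : Hist N A X) : Prop := (H.map Sigma.fst).Nodup

/-- The causal-model expression of Definition 1, written recursively:
`causalSum q o x a k H` sums over the next `k` parties to act (those not occurring
in the history `H`), multiplying the 'who is next?' probabilities `q` and the
'what did they see?' probabilities `o` and extending the history accordingly.
The full expression of Definition 1 is `causalSum q o x a N []`. -/
def causalSum (q : Hist N A X → Fin N → ℝ)
    (o : Hist N A X → (l : Fin N) → X l → A l → ℝ)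
    (x : ∀ i, X i) (a : ∀ i, A i) : ℕ → Hist N A X → ℝ
  | 0, _ => 1
  | k + 1, H =>
      ∑ l : Fin N,
        if ∀ e ∈ H, e.1 ≠ l then
          q H l * o H l (x l) (a l) * causalSum q o x a k (H ++ [⟨l, (a l, x l)⟩])
        else 0

/-- Definition 1: `p(a⃗|x⃗)` is causal if there are conditional probabilities
`q H l` (a distribution over the labs `l` not occurring in `H`) and `o H l xv a`
(a distribution over the outcomes `A l`), depending only on the history (and, for
outcomes, the acting party's own setting), whose causal-model expression
reproduces `p`. -/
def IsCausal (p : (∀ i, X i) → (∀ i, A i) → ℝ) : Prop :=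
  ∃ (q : Hist N A X → Fin N → ℝ) (o : Hist N A X → (l : Fin N) → X l → A l → ℝ),
    (∀ (H : Hist N A X) (l : Fin N), 0 ≤ q H l) ∧
    (∀ (H : Hist N A X) (l : Fin N) (xv : X l) (a : A l), 0 ≤ o H l xv a) ∧
    (∀ H : Hist N A X, labsDistinct H → H.length < N →
      ∑ l ∈ Finset.univ.filter (fun l : Fin N => ∀ e ∈ H, e.1 ≠ l), q H l = 1) ∧
    (∀ (H : Hist N A X) (l : Fin N) (xv : X l), ∑ a : A l, o H l xv a = 1) ∧
    (∀ (x : ∀ i, X i) (a : ∀ i, A i), p x a = causalSum q o x a N [])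

/-- The average of `u` and `u'` with weights `w` and `w'`, and `u` if the weights add up to zero. -/
def weightedMean (w w' u u' : ℝ) : ℝ :=
  if w + w' = 0 then u else (w * u + w' * u') / (w + w')

theorem weightedMean_nonneg {w w' u u' : ℝ} (hw : 0 ≤ w) (hw' : 0 ≤ w') (hu : 0 ≤ u)
    (hu' : 0 ≤ u') : 0 ≤ weightedMean w w' u u' := by
  unfold weightedMean
  split_ifs
  · exact hu
  · positivity

theorem add_mul_weightedMean {w w' : ℝ} (hw : 0 ≤ w) (hw' : 0 ≤ w') (u u' : ℝ) :
    (w + w') * weightedMean w w' u u' = w * u + w' * u' := by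
  unfold weightedMean
  split_ifs with h
  · obtain ⟨rfl, rfl⟩ := (add_eq_zero_iff_of_nonneg hw hw').1 h
    simp
  · exact mul_div_cancel₀ _ h

theorem sum_weightedMean {ι : Type*} {s : Finset ι} {u u' : ι → ℝ} (w w' : ℝ)
    (hu : ∑ i ∈ s, u i = 1) (hu' : ∑ i ∈ s, u' i = 1) :
    ∑ i ∈ s, weightedMean w w' (u i) (u' i) = 1 := by
  unfold weightedMean
  split_ifs with h
  · exact hu
  · rw [← Finset.sum_div, Finset.sum_add_distrib, ← Finset.mul_sum, ← Finset.mul_sum, hu, hu',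
      mul_one, mul_one, div_self h]

/-- The probability that the history `P`, once reached, is continued by the triples in `T`,
given the settings occurring in `T`. -/
def pathWeight (q : Hist N A X → Fin N → ℝ)
    (o : Hist N A X → (l : Fin N) → X l → A l → ℝ) : Hist N A X → Hist N A X → ℝ
  | _, [] => 1
  | P, e :: T => q P e.1 * o P e.1 e.2.2 e.2.1 * pathWeight q o (P ++ [e]) T

theorem pathWeight_nonneg {N : ℕ} {A X : Fin N → Type} {q : Hist N A X → Fin N → ℝ}
    {o : Hist N A X → (l : Fin N) → X l → A l → ℝ}
    (hq : ∀ H l, 0 ≤ q H l) (ho : ∀ H l xv a, 0 ≤ o H l xv a) (P T : Hist N A X) :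
    0 ≤ pathWeight q o P T := by
  induction T generalizing P with
  | nil => exact zero_le_one
  | cons e T ih => exact mul_nonneg (mul_nonneg (hq _ _) (ho _ _ _ _)) (ih _)

theorem pathWeight_append_singleton {N : ℕ} {A X : Fin N → Type} (q : Hist N A X → Fin N → ℝ)
    (o : Hist N A X → (l : Fin N) → X l → A l → ℝ) (P T : Hist N A X)
    (e : (l : Fin N) × (A l × X l)) :
    pathWeight q o P (T ++ [e]) =
      pathWeight q o P T * q (P ++ T) e.1 * o (P ++ T) e.1 e.2.2 e.2.1 := by
  induction T generalizing P with
  | nil => simp [pathWeight]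
  | cons f T ih => simp [pathWeight, ih, mul_assoc]

/-- If the weights `w`, `w₁`, `w₂` of histories are extended by one triple according to
three causal models, and `w = w₁ + w₂`, then the weighted causal sums add up in the same way. -/
theorem mul_causalSum_eq_add
    {q q₁ q₂ : Hist N A X → Fin N → ℝ} {o o₁ o₂ : Hist N A X → (l : Fin N) → X l → A l → ℝ}
    {w w₁ w₂ : Hist N A X → ℝ}
    (hw : ∀ H l xv a, w (H ++ [⟨l, (a, xv)⟩]) = w H * q H l * o H l xv a)
    (hw₁ : ∀ H l xv a, w₁ (H ++ [⟨l, (a, xv)⟩]) = w₁ H * q₁ H l * o₁ H l xv a)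
    (hw₂ : ∀ H l xv a, w₂ (H ++ [⟨l, (a, xv)⟩]) = w₂ H * q₂ H l * o₂ H l xv a)
    (hadd : ∀ H, w H = w₁ H + w₂ H) (x : ∀ i, X i) (a : ∀ i, A i) (k : ℕ) (H : Hist N A X) :
    w H * causalSum q o x a k H =
      w₁ H * causalSum q₁ o₁ x a k H + w₂ H * causalSum q₂ o₂ x a k H := by
  induction k generalizing H with
  | zero => simp [causalSum, hadd]
  | succ k ih =>
    simp only [causalSum, Finset.mul_sum, ← Finset.sum_add_distrib]
    refine Finset.sum_congr rfl fun l _ => ?_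
    split_ifs
    · have h := ih (H ++ [⟨l, (a l, x l)⟩])
      rw [hw, hw₁, hw₂] at h
      linear_combination h
    · simp

/-- Convexity of causal distributions: if `p` and `p'` are causal and `0 ≤ λ ≤ 1`,
then `λ p + (1−λ) p'` is causal. -/
theorem isCausal_convex
    (N : ℕ) (A : Fin N → Type) [∀ i, Fintype (A i)] [∀ i, DecidableEq (A i)]
    (X : Fin N → Type) [∀ i, Fintype (X i)] [∀ i, DecidableEq (X i)]
    (p p' : (∀ i, X i) → (∀ i, A i) → ℝ)
    (hp : IsCausal p) (hp' : IsCausal p')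
    (lam : ℝ) (h0 : 0 ≤ lam) (h1 : lam ≤ 1) :
    IsCausal (fun x a => lam * p x a + (1 - lam) * p' x a) := by
  obtain ⟨q₁, o₁, hq₁, ho₁, hqs₁, hos₁, hp₁⟩ := hp
  obtain ⟨q₂, o₂, hq₂, ho₂, hqs₂, hos₂, hp₂⟩ := hp'
  set w₁ : Hist N A X → ℝ := fun H => lam * pathWeight q₁ o₁ [] H with hw₁
  set w₂ : Hist N A X → ℝ := fun H => (1 - lam) * pathWeight q₂ o₂ [] H with hw₂
  have w₁_nonneg (H) : 0 ≤ w₁ H := mul_nonneg h0 (pathWeight_nonneg hq₁ ho₁ _ _)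
  have w₂_nonneg (H) : 0 ≤ w₂ H :=
    mul_nonneg (sub_nonneg.2 h1) (pathWeight_nonneg hq₂ ho₂ _ _)
  have w₁_snoc (H l xv a) : w₁ (H ++ [⟨l, (a, xv)⟩]) = w₁ H * q₁ H l * o₁ H l xv a := by
    simp [hw₁, pathWeight_append_singleton, mul_assoc]
  have w₂_snoc (H l xv a) : w₂ (H ++ [⟨l, (a, xv)⟩]) = w₂ H * q₂ H l * o₂ H l xv a := by
    simp [hw₂, pathWeight_append_singleton, mul_assoc]
  have wq₁_nonneg (H l) : 0 ≤ w₁ H * q₁ H l := mul_nonneg (w₁_nonneg H) (hq₁ H l)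
  have wq₂_nonneg (H l) : 0 ≤ w₂ H * q₂ H l := mul_nonneg (w₂_nonneg H) (hq₂ H l)
  refine ⟨fun H l => weightedMean (w₁ H) (w₂ H) (q₁ H l) (q₂ H l),
    fun H l xv a =>
      weightedMean (w₁ H * q₁ H l) (w₂ H * q₂ H l) (o₁ H l xv a) (o₂ H l xv a),
    fun H l => weightedMean_nonneg (w₁_nonneg H) (w₂_nonneg H) (hq₁ H l) (hq₂ H l),
    fun H l xv a => weightedMean_nonneg (wq₁_nonneg H l) (wq₂_nonneg H l)
      (ho₁ H l xv a) (ho₂ H l xv a),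
    fun H hH hN => sum_weightedMean _ _ (hqs₁ H hH hN) (hqs₂ H hH hN),
    fun H l xv => sum_weightedMean _ _ (hos₁ H l xv) (hos₂ H l xv), fun x a => ?_⟩
  have h := mul_causalSum_eq_add (w := fun H => w₁ H + w₂ H)
    (q := fun H l => weightedMean (w₁ H) (w₂ H) (q₁ H l) (q₂ H l))
    (o := fun H l xv a =>
      weightedMean (w₁ H * q₁ H l) (w₂ H * q₂ H l) (o₁ H l xv a) (o₂ H l xv a))
    (fun H l xv a => by
      rw [add_mul_weightedMean (w₁_nonneg H) (w₂_nonneg H),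
        add_mul_weightedMean (wq₁_nonneg H l) (wq₂_nonneg H l), w₁_snoc, w₂_snoc])
    w₁_snoc w₂_snoc (fun _ => rfl) x a N []
  simp only [hw₁, hw₂, pathWeight, mul_one, add_sub_cancel, one_mul] at h
  simpa only [hp₁, hp₂] using h.symm

end CIQC

end
end

section
/- Bipartite characterization: a conditional distribution p(ab|xy) for two parties (Alice with setting x and outcome a, Bob with setting y and outcome b, over finite sets) is causal in the sense of Definition 1 with N = 2 if and only if it admits a decomposition p(ab|xy) = q · p_A(a|x) · p_{B|A}(b|a,x,y) + (1−q) · p_B(b|y) · p_{A|B}(a|b,x,y), where q ∈ [0,1] and p_A(·|x), p_{B|A}(·|a,x,y), p_B(·|y), p_{A|B}(·|b,x,y) are conditional probability distributions over the respective outcome sets. -/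
/-!
Causal models (Definition 1 of Purves & Short, "Quantum theory cannot violate a
causal inequality"): `N` parties with finite outcome sets `A i` and finite setting
sets `X i`.  A conditional distribution `p(a⃗|x⃗)` is causal if it is reproduced by
'who is next?' probabilities `q` and 'what did they see?' probabilities `o`,
conditioned on histories (ordered lists of (lab, outcome, setting) triples).
-/

noncomputable section

namespace CIQC

variable {N : ℕ}
variable {A : Fin N → Type} [∀ i, Fintype (A i)] [∀ i, DecidableEq (A i)]
variable {X : Fin N → Type} [∀ i, Fintype (X i)] [∀ i, DecidableEq (X i)]

/-- Alice acts first with probability `r`; afterwards the remaining lab acts. -/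
def bipartiteOrder {A X : Fin 2 → Type} (r : ℝ) : Hist 2 A X → Fin 2 → ℝ
  | [], l => if l = 0 then r else 1 - r
  | _ :: _, _ => 1

/-- Alice's outcome distribution: `f` given Bob's earlier triple, `g` otherwise. -/
def aliceOutcome {A X : Fin 2 → Type} (g : X 0 → A 0 → ℝ)
    (f : A 1 → X 0 → X 1 → A 0 → ℝ) : Hist 2 A X → X 0 → A 0 → ℝ
  | [⟨1, (b, y)⟩], x => f b x y
  | _, x => g x

/-- Bob's outcome distribution: `f` given Alice's earlier triple, `g` otherwise. -/
def bobOutcome {A X : Fin 2 → Type} (g : X 1 → A 1 → ℝ)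
    (f : A 0 → X 0 → X 1 → A 1 → ℝ) : Hist 2 A X → X 1 → A 1 → ℝ
  | [⟨0, (a, x)⟩], y => f a x y
  | _, y => g y

/-- A family of outcome distributions assembled from Alice's and Bob's. -/
def bipartiteOutcome {A X : Fin 2 → Type} (f : Hist 2 A X → X 0 → A 0 → ℝ)
    (g : Hist 2 A X → X 1 → A 1 → ℝ) (H : Hist 2 A X) : (l : Fin 2) → X l → A l → ℝ
  | 0 => f H
  | 1 => g H

theorem aliceOutcome_mem {A X : Fin 2 → Type} {g : X 0 → A 0 → ℝ}
    {f : A 1 → X 0 → X 1 → A 0 → ℝ} {P : (A 0 → ℝ) → Prop} (hg : ∀ x, P (g x))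
    (hf : ∀ b x y, P (f b x y)) (H : Hist 2 A X) (x : X 0) : P (aliceOutcome g f H x) := by
  unfold aliceOutcome
  split
  · exact hf _ _ _
  · exact hg _

theorem bobOutcome_mem {A X : Fin 2 → Type} {g : X 1 → A 1 → ℝ}
    {f : A 0 → X 0 → X 1 → A 1 → ℝ} {P : (A 1 → ℝ) → Prop} (hg : ∀ y, P (g y))
    (hf : ∀ a x y, P (f a x y)) (H : Hist 2 A X) (y : X 1) : P (bobOutcome g f H y) := by
  unfold bobOutcome
  split
  · exact hf _ _ _
  · exact hg _

/-- The two-party causal-model expression written out. -/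
theorem causalSum_two {A X : Fin 2 → Type} [∀ i, Fintype (A i)] [∀ i, DecidableEq (A i)]
    [∀ i, Fintype (X i)] [∀ i, DecidableEq (X i)] (q : Hist 2 A X → Fin 2 → ℝ)
    (o : Hist 2 A X → (l : Fin 2) → X l → A l → ℝ) (x : ∀ i, X i) (a : ∀ i, A i) :
    causalSum q o x a 2 [] =
      q [] 0 * o [] 0 (x 0) (a 0) *
        (q [⟨0, (a 0, x 0)⟩] 1 * o [⟨0, (a 0, x 0)⟩] 1 (x 1) (a 1)) +
      q [] 1 * o [] 1 (x 1) (a 1) *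
        (q [⟨1, (a 1, x 1)⟩] 0 * o [⟨1, (a 1, x 1)⟩] 0 (x 0) (a 0)) := by
  simp [causalSum, Fin.sum_univ_two]

theorem sum_bipartiteOrder {A X : Fin 2 → Type} (r : ℝ) (H : Hist 2 A X) (hH : H.length < 2) :
    ∑ l ∈ Finset.univ.filter (fun l : Fin 2 => ∀ e ∈ H, e.1 ≠ l), bipartiteOrder r H l = 1 := by
  match H, hH with
  | [], _ => simp [bipartiteOrder, Fin.sum_univ_two]
  | [⟨l, w⟩], _ => fin_cases l <;> simp [bipartiteOrder] <;> rfl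

/-- Bipartite characterization: a two-party conditional distribution (Alice `= 0`
with setting `x` and outcome `a`, Bob `= 1` with setting `y` and outcome `b`) is
causal in the sense of Definition 1 iff it decomposes as
`p(ab|xy) = q·p_A(a|x)·p_{B|A}(b|a,x,y) + (1−q)·p_B(b|y)·p_{A|B}(a|b,x,y)`
with `q ∈ [0,1]` and the listed factors conditional probability distributions. -/
theorem bipartite_causal_iff
    (A : Fin 2 → Type) [∀ i, Fintype (A i)] [∀ i, DecidableEq (A i)]
    (X : Fin 2 → Type) [∀ i, Fintype (X i)] [∀ i, DecidableEq (X i)]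
    (p : (∀ i, X i) → (∀ i, A i) → ℝ) :
    IsCausal p ↔
      ∃ (qc : ℝ) (pA : X 0 → A 0 → ℝ) (pBA : A 0 → X 0 → X 1 → A 1 → ℝ)
        (pB : X 1 → A 1 → ℝ) (pAB : A 1 → X 0 → X 1 → A 0 → ℝ),
        0 ≤ qc ∧ qc ≤ 1 ∧
        (∀ x0 a0, 0 ≤ pA x0 a0) ∧ (∀ a0 x0 x1 a1, 0 ≤ pBA a0 x0 x1 a1) ∧
        (∀ x1 a1, 0 ≤ pB x1 a1) ∧ (∀ a1 x0 x1 a0, 0 ≤ pAB a1 x0 x1 a0) ∧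
        (∀ x0, ∑ a0 : A 0, pA x0 a0 = 1) ∧
        (∀ a0 x0 x1, ∑ a1 : A 1, pBA a0 x0 x1 a1 = 1) ∧
        (∀ x1, ∑ a1 : A 1, pB x1 a1 = 1) ∧
        (∀ a1 x0 x1, ∑ a0 : A 0, pAB a1 x0 x1 a0 = 1) ∧
        (∀ (x : ∀ i, X i) (a : ∀ i, A i),
          p x a = qc * pA (x 0) (a 0) * pBA (a 0) (x 0) (x 1) (a 1)
            + (1 - qc) * pB (x 1) (a 1) * pAB (a 1) (x 0) (x 1) (a 0)) := by
  constructor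
  · rintro ⟨q, o, hq, ho, hq1, ho1, hp⟩
    have h0 : q [] 0 + q [] 1 = 1 := by
      simpa [Fin.sum_univ_two] using hq1 [] (by simp [labsDistinct]) (by simp)
    have hA : ∀ w, q [⟨0, w⟩] 1 = 1 := fun w => by
      simpa [Finset.sum_filter, Fin.sum_univ_two] using
        hq1 [⟨0, w⟩] (by simp [labsDistinct]) (by simp)
    have hB : ∀ w, q [⟨1, w⟩] 0 = 1 := fun w => by
      simpa [Finset.sum_filter, Fin.sum_univ_two] using
        hq1 [⟨1, w⟩] (by simp [labsDistinct]) (by simp)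
    refine ⟨q [] 0, o [] 0, fun a x y => o [⟨0, (a, x)⟩] 1 y, o [] 1,
      fun b x y => o [⟨1, (b, y)⟩] 0 x, hq _ _, by linarith [hq [] 1], ho _ _,
      fun _ _ _ => ho _ _ _, ho _ _, fun _ _ _ => ho _ _ _, ho1 _ _,
      fun _ _ _ => ho1 _ _ _, ho1 _ _, fun _ _ _ => ho1 _ _ _, fun x a => ?_⟩
    rw [hp, causalSum_two, hA, hB, one_mul, one_mul, ← h0, add_sub_cancel_left]
  · rintro ⟨r, pA, pBA, pB, pAB, hr0, hr1, hA, hBA, hB, hAB, sA, sBA, sB, sAB, hp⟩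
    refine ⟨bipartiteOrder r, bipartiteOutcome (aliceOutcome pA pAB) (bobOutcome pB pBA),
      ?_, ?_, ?_, ?_, fun x a => ?_⟩
    · intro H l
      unfold bipartiteOrder
      split
      · split_ifs <;> linarith
      · exact zero_le_one
    · intro H l
      match l with
      | 0 => exact aliceOutcome_mem (P := fun v => ∀ a, 0 ≤ v a) hA hAB H
      | 1 => exact bobOutcome_mem (P := fun v => ∀ b, 0 ≤ v b) hB hBA H
    · intro H _ hH
      convert sum_bipartiteOrder r H hH
    · intro H l
      match l with
      | 0 => exact aliceOutcome_mem (P := fun v => ∑ a, v a = 1) sA sAB H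
      | 1 => exact bobOutcome_mem (P := fun v => ∑ b, v b = 1) sB sBA H
    · rw [hp, causalSum_two]
      simp [bipartiteOrder, bipartiteOutcome, aliceOutcome, bobOutcome]

end CIQC

end
end
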